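/- arXiv:0806.2788 — 2 statements merged into one kernel-verified Lean document; each statement's English description precedes it below -/
import Mathlib

section
/- Let R be an aperiodic p.m.p. countable Borel equivalence relation on a standard probability space. Then R is freely indecomposable if and only if every free product decomposition of R into two factors R = S₁ * S₂ is inessential. -/
open MeasureTheory

/-- A countable Borel equivalence relation on `X`, defined on a Borel domain `dom`:
it is Borel as a subset of `X × X`, is an equivalence relation on `dom`, and has
countable classes. -/
structure CBER (X : Type) [MeasurableSpace X] where
  dom : Set X
  dom_meas : MeasurableSet dom
  rel : X → X → Prop
  rel_meas : MeasurableSet {p : X × X | rel p.1 p.2}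
  rel_dom : ∀ {x y : X}, rel x y → x ∈ dom ∧ y ∈ dom
  refl : ∀ x ∈ dom, rel x x
  symm : ∀ {x y : X}, rel x y → rel y x
  trans : ∀ {x y z : X}, rel x y → rel y z → rel x z
  countable_classes : ∀ x : X, {y | rel x y}.Countable

/-- The class of `x`. -/
def CBER.cls {X : Type} [MeasurableSpace X] (R : CBER X) (x : X) : Set X := {y | R.rel x y}

/-- The `R`-saturation of a set `A`: the union of the `R`-classes meeting `A`. -/
def CBER.sat {X : Type} [MeasurableSpace X] (R : CBER X) (A : Set X) : Set X :=
  {y | ∃ x ∈ A, R.rel x y}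

/-- A complete section: a Borel subset of the domain meeting every class. -/
def CBER.IsCompleteSection {X : Type} [MeasurableSpace X] (R : CBER X) (A : Set X) : Prop :=
  MeasurableSet A ∧ A ⊆ R.dom ∧ ∀ x ∈ R.dom, ∃ y ∈ A, R.rel x y

/-- A smooth CBER: one admitting a Borel fundamental domain (a Borel set meeting
every class exactly once). -/
def CBER.Smooth {X : Type} [MeasurableSpace X] (R : CBER X) : Prop :=
  ∃ D : Set X, MeasurableSet D ∧ D ⊆ R.dom ∧ ∀ x ∈ R.dom, ∃! y, y ∈ D ∧ R.rel x y

/-- Smoothness of the restriction `R|A`. -/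
def CBER.SmoothOn {X : Type} [MeasurableSpace X] (R : CBER X) (A : Set X) : Prop :=
  ∃ D : Set X, MeasurableSet D ∧ D ⊆ A ∧ ∀ x ∈ R.dom ∩ A, ∃! y, y ∈ D ∧ R.rel x y

/-- All classes are finite. -/
def CBER.FiniteClasses {X : Type} [MeasurableSpace X] (R : CBER X) : Prop :=
  ∀ x ∈ R.dom, (R.cls x).Finite

/-- Aperiodic: all classes are infinite (on the domain). -/
def CBER.Aperiodic {X : Type} [MeasurableSpace X] (R : CBER X) : Prop :=
  ∀ x ∈ R.dom, (R.cls x).Infinite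

/-- Trivial: all classes are singletons. -/
def CBER.TrivialClasses {X : Type} [MeasurableSpace X] (R : CBER X) : Prop :=
  ∀ x y, R.rel x y → x = y

/-- The restriction `R|U` of `R` to a Borel set `U`. -/
def CBER.restrict {X : Type} [MeasurableSpace X] (R : CBER X) (U : Set X)
    (hU : MeasurableSet U) : CBER X where
  dom := R.dom ∩ U
  dom_meas := R.dom_meas.inter hU
  rel x y := R.rel x y ∧ x ∈ U ∧ y ∈ U
  rel_meas := by
    have h : {p : X × X | R.rel p.1 p.2 ∧ p.1 ∈ U ∧ p.2 ∈ U} =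
        {p : X × X | R.rel p.1 p.2} ∩ (Prod.fst ⁻¹' U ∩ Prod.snd ⁻¹' U) := by
      ext p
      simp only [Set.mem_setOf_eq, Set.mem_inter_iff, Set.mem_preimage, and_assoc]
    rw [h]
    exact R.rel_meas.inter ((measurable_fst hU).inter (measurable_snd hU))
  rel_dom := fun h => ⟨⟨(R.rel_dom h.1).1, h.2.1⟩, ⟨(R.rel_dom h.1).2, h.2.2⟩⟩
  refl := fun x hx => ⟨R.refl x hx.1, hx.2, hx.2⟩
  symm := fun h => ⟨R.symm h.1, h.2.2, h.2.1⟩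
  trans := fun h h' => ⟨R.trans h.1 h'.1, h.2.1, h'.2.2⟩
  countable_classes := fun x =>
    Set.Countable.mono (fun y hy => hy.1) (R.countable_classes x)

/-- `S` is a subrelation of `R`. -/
def CBER.IsSubrelOf {X : Type} [MeasurableSpace X] (S R : CBER X) : Prop :=
  S.dom ⊆ R.dom ∧ ∀ x y, S.rel x y → R.rel x y

/-- A partial Borel isomorphism between Borel subsets `src` and `tgt` of `X`. -/
structure PBI (X : Type) [MeasurableSpace X] where
  src : Set X
  tgt : Set X
  src_meas : MeasurableSet src
  tgt_meas : MeasurableSet tgt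
  toFun : X → X
  invFun : X → X
  meas_toFun : Measurable toFun
  meas_invFun : Measurable invFun
  mapsTo : Set.MapsTo toFun src tgt
  mapsTo_inv : Set.MapsTo invFun tgt src
  left_inv : ∀ x ∈ src, invFun (toFun x) = x
  right_inv : ∀ y ∈ tgt, toFun (invFun y) = y

/-- Membership in the full pseudogroup `[[R]]`: a partial Borel isomorphism whose
graph is contained in `R`. -/
def CBER.InPseudogroup {X : Type} [MeasurableSpace X] (R : CBER X) (φ : PBI X) : Prop :=
  φ.src ⊆ R.dom ∧ ∀ x ∈ φ.src, R.rel x (φ.toFun x)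

/-- Two subrelations `S₁`, `S₂` of `R` are inner conjugate in `R` if some element of the
full pseudogroup of `R` with domain `D(S₂)` and target `D(S₁)` conjugates one to the other. -/
def InnerConjugate {X : Type} [MeasurableSpace X] (R S₁ S₂ : CBER X) : Prop :=
  ∃ φ : PBI X, R.InPseudogroup φ ∧ φ.src = S₂.dom ∧ φ.tgt = S₁.dom ∧
    ∀ x ∈ φ.src, ∀ y ∈ φ.src, (S₂.rel x y ↔ S₁.rel (φ.toFun x) (φ.toFun y))

/-- `R` preserves the measure `μ`: every element of its full pseudogroup preserves `μ`. -/
def CBER.IsPMP {X : Type} [MeasurableSpace X] (R : CBER X) (μ : Measure X) : Prop :=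
  ∀ φ : PBI X, R.InPseudogroup φ → ∀ A : Set X, A ⊆ φ.src → MeasurableSet A →
    μ (φ.toFun '' A) = μ A

/-- Free independence of a family of equivalence relations: any cycle alternating
nontrivially among the factors must have two consecutive steps in the same factor. -/
def FreelyIndep {X : Type} [MeasurableSpace X] {ι : Type} (Rf : ι → CBER X) : Prop :=
  ∀ (n : ℕ) (x : ℕ → X) (i : ℕ → ι), 2 ≤ n → x n = x 0 →
    (∀ j < n, x j ≠ x (j + 1)) → (∀ j < n, (Rf (i j)).rel (x j) (x (j + 1))) →
    ∃ j, j + 1 < n ∧ i j = i (j + 1)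

/-- `R` is the free product of the family `Rf`: the family is freely independent and `R`
is the smallest equivalence relation on the union of the domains containing every `Rf i`. -/
def IsFreeProduct {X : Type} [MeasurableSpace X] {ι : Type} (R : CBER X)
    (Rf : ι → CBER X) : Prop :=
  FreelyIndep Rf ∧ R.dom = (⋃ i, (Rf i).dom) ∧
    ∀ x y, R.rel x y ↔
      (x ∈ R.dom ∧ Relation.EqvGen (fun a b => ∃ i, (Rf i).rel a b) x y)

/-- The partition `U = ⊔ⱼ Uⱼ` trivializes the free product decomposition `R = *ⱼ Rf j`:
`U` is a complete section for `R`, the partition is `R|U`-invariant, and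
`R|Uⱼ = (Rf j)|Uⱼ` for every `j`. -/
def Trivializes {X : Type} [MeasurableSpace X] {ι : Type}
    (R : CBER X) (Rf : ι → CBER X) (U : ι → Set X) : Prop :=
  (∀ j, MeasurableSet (U j)) ∧ (∀ j, U j ⊆ R.dom) ∧
  Pairwise (Function.onFun Disjoint U) ∧
  (∀ x ∈ R.dom, ∃ y ∈ ⋃ j, U j, R.rel x y) ∧
  (∀ i j : ι, ∀ x ∈ U i, ∀ y ∈ U j, R.rel x y → i = j) ∧
  (∀ j, ∀ x ∈ U j, ∀ y ∈ U j, (R.rel x y ↔ (Rf j).rel x y))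

/-- A free product decomposition is inessential if it admits a trivialization. -/
def Inessential {X : Type} [MeasurableSpace X] {ι : Type}
    (R : CBER X) (Rf : ι → CBER X) : Prop :=
  ∃ U : ι → Set X, Trivializes R Rf U

/-- Freely indecomposable (Borel context): every free product decomposition is inessential. -/
def FreelyIndecomposable {X : Type} [MeasurableSpace X] (R : CBER X) : Prop :=
  ∀ (ι : Type) (_ : Countable ι) (Rf : ι → CBER X), IsFreeProduct R Rf → Inessential R Rf

/-- Inessential decomposition in the measured context: a trivialization up to `μ`-null sets. -/
def InessentialMod {X : Type} [MeasurableSpace X] (μ : Measure X) {ι : Type}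
    (R : CBER X) (Rf : ι → CBER X) : Prop :=
  ∃ (U : ι → Set X) (C : Set X),
    (∀ j, MeasurableSet (U j)) ∧ (∀ j, U j ⊆ R.dom) ∧
    Pairwise (Function.onFun Disjoint U) ∧
    MeasurableSet C ∧ μ Cᶜ = 0 ∧
    (∀ x ∈ R.dom ∩ C, ∃ y ∈ ⋃ j, U j, R.rel x y) ∧
    (∀ i j : ι, ∀ x ∈ U i ∩ C, ∀ y ∈ U j ∩ C, R.rel x y → i = j) ∧
    (∀ j, ∀ x ∈ U j ∩ C, ∀ y ∈ U j ∩ C, (R.rel x y ↔ (Rf j).rel x y))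

/-- Freely indecomposable (measured context): every free product decomposition is
inessential up to `μ`-null sets. -/
def FreelyIndecomposableMod {X : Type} [MeasurableSpace X] (μ : Measure X)
    (R : CBER X) : Prop :=
  ∀ (ι : Type) (_ : Countable ι) (Rf : ι → CBER X), IsFreeProduct R Rf →
    InessentialMod μ R Rf

/-- One step of a word in a graphing: apply `φ` (if `e = true`) or `φ⁻¹` (if `e = false`). -/
def PBIStep {X : Type} [MeasurableSpace X] (φ : PBI X) : Bool → X → X → Prop
  | true, a, b => a ∈ φ.src ∧ φ.toFun a = b
  | false, a, b => a ∈ φ.tgt ∧ φ.invFun a = b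

/-- A treeing: any cyclic word in the generators and their inverses admits a reduction. -/
def IsTreeing {X : Type} [MeasurableSpace X] {ι : Type} (Φ : ι → PBI X) : Prop :=
  ∀ (n : ℕ) (i : ℕ → ι) (ε : ℕ → Bool) (x : ℕ → X),
    0 < n → x n = x 0 → (∀ j < n, PBIStep (Φ (i j)) (ε j) (x j) (x (j + 1))) →
    ∃ j, j + 1 < n ∧ i j = i (j + 1) ∧ ε j ≠ ε (j + 1)

/-- The graphing `Φ` generates `R`: `R` is the smallest equivalence relation on the union of
the sources and targets containing the graphs of the `Φ i`. -/
def GeneratesCBER {X : Type} [MeasurableSpace X] {ι : Type} (Φ : ι → PBI X)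
    (R : CBER X) : Prop :=
  R.dom = (⋃ i, ((Φ i).src ∪ (Φ i).tgt)) ∧ (∀ i, R.InPseudogroup (Φ i)) ∧
    ∀ x y, R.rel x y ↔ (x ∈ R.dom ∧
      Relation.EqvGen (fun a b => ∃ i, a ∈ (Φ i).src ∧ (Φ i).toFun a = b) x y)

/-- Treeable: generated by some (countable) treeing. -/
def CBER.Treeable {X : Type} [MeasurableSpace X] (R : CBER X) : Prop :=
  ∃ Φ : ℕ → PBI X, IsTreeing Φ ∧ GeneratesCBER Φ R

/-- Hyperfinite: increasing union of finite Borel subrelations. -/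
def CBER.Hyperfinite {X : Type} [MeasurableSpace X] (R : CBER X) : Prop :=
  ∃ S : ℕ → CBER X, (∀ n, (S n).IsSubrelOf R) ∧ (∀ n, (S n).FiniteClasses) ∧
    (∀ n, (S n).dom = R.dom) ∧ (∀ n, ∀ x y, (S n).rel x y → (S (n + 1)).rel x y) ∧
    ∀ x y, R.rel x y → ∃ n, (S n).rel x y

/-- Ergodicity of a measured CBER: every invariant Borel set is null or conull. -/
def ErgodicCBER {X : Type} [MeasurableSpace X] (R : CBER X) (μ : Measure X) : Prop :=
  ∀ A : Set X, MeasurableSet A → (∀ x ∈ A, ∀ y, R.rel x y → y ∈ A) →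
    μ A = 0 ∨ μ Aᶜ = 0

/-- A stable orbit equivalence between measured CBERs: a Borel isomorphism between
complete sections (mod null sets), sending the normalized measure to the normalized
measure, and preserving the relations a.e. -/
structure SOEquiv {X Y : Type} [MeasurableSpace X] [MeasurableSpace Y]
    (R : CBER X) (μ : Measure X) (S : CBER Y) (ν : Measure Y) where
  A : Set X
  B : Set Y
  toFun : X → Y
  invFun : Y → X
  measA : MeasurableSet A
  measB : MeasurableSet B
  A_sub : A ⊆ R.dom
  B_sub : B ⊆ S.dom
  A_pos : 0 < μ A
  B_pos : 0 < ν B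
  A_section : ∀ᵐ x ∂μ, x ∈ R.dom → ∃ y ∈ A, R.rel x y
  B_section : ∀ᵐ y ∂ν, y ∈ S.dom → ∃ z ∈ B, S.rel y z
  meas_toFun : Measurable toFun
  meas_invFun : Measurable invFun
  mapsTo : Set.MapsTo toFun A B
  mapsTo_inv : Set.MapsTo invFun B A
  left_inv : ∀ x ∈ A, invFun (toFun x) = x
  right_inv : ∀ y ∈ B, toFun (invFun y) = y
  measure_eq : ∀ E : Set X, E ⊆ A → MeasurableSet E →
    (μ A)⁻¹ * μ E = (ν B)⁻¹ * ν (toFun '' E)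
  rel_iff : ∃ C : Set X, MeasurableSet C ∧ μ (A \ C) = 0 ∧
    ∀ x ∈ A ∩ C, ∀ y ∈ A ∩ C, (R.rel x y ↔ S.rel (toFun x) (toFun y))

/-- Stable orbit equivalence. -/
def SOE {X Y : Type} [MeasurableSpace X] [MeasurableSpace Y]
    (R : CBER X) (μ : Measure X) (S : CBER Y) (ν : Measure Y) : Prop :=
  Nonempty (SOEquiv R μ S ν)

/-- Orbit equivalence: a stable orbit equivalence where one can take the complete
sections to be the full spaces. -/
def OE {X Y : Type} [MeasurableSpace X] [MeasurableSpace Y]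
    (R : CBER X) (μ : Measure X) (S : CBER Y) (ν : Measure Y) : Prop :=
  ∃ E : SOEquiv R μ S ν, E.A = Set.univ ∧ E.B = Set.univ

/-- A probability measure preserving action of a group `G` on a measured space. -/
structure PMPAction (G : Type) [Group G] (X : Type) [MeasurableSpace X]
    (μ : Measure X) where
  act : G → X → X
  act_one : ∀ x, act 1 x = x
  act_mul : ∀ g h x, act (g * h) x = act g (act h x)
  measurePreserving : ∀ g, MeasurePreserving (act g) μ μ

/-- Essential freeness: a.e. point has trivial stabilizer. -/
def PMPAction.IsFree {G X : Type} [Group G] [MeasurableSpace X] {μ : Measure X}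
    (α : PMPAction G X μ) : Prop :=
  ∀ᵐ x ∂μ, ∀ g : G, α.act g x = x → g = 1

/-- `R` is the orbit equivalence relation of the action `α` restricted to the subgroup `H`. -/
def IsOrbitRel {G X : Type} [Group G] [MeasurableSpace X] {μ : Measure X}
    (α : PMPAction G X μ) (H : Subgroup G) (R : CBER X) : Prop :=
  R.dom = Set.univ ∧ ∀ x y, (R.rel x y ↔ ∃ g ∈ H, α.act g x = y)

/-- A countable group is measurably freely indecomposable (MFI) if the orbit equivalence
relation of every free p.m.p. action of it on a standard probability space is freely
indecomposable. -/
def MFI (G : Type) [Group G] [Countable G] : Prop :=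
  ∀ (X : Type) [MeasurableSpace X] [StandardBorelSpace X]
    (μ : Measure X) [IsProbabilityMeasure μ]
    (α : PMPAction G X μ) (R : CBER X),
    α.IsFree → IsOrbitRel α ⊤ R → FreelyIndecomposableMod μ R

/-- `G` is the internal free product of the family of subgroups `H`. -/
def IsFreeProductOf (G : Type) [Group G] {ι : Type} (H : ι → Subgroup G) : Prop :=
  Function.Bijective (Monoid.CoprodI.lift fun i => (H i).subtype)

/-- A Borel fundamental domain for an action, of the coupling kind: meets a.e. orbit,
and meets each orbit at most once mod null. -/
def IsFundamentalDomainFor {G : Type} [Group G] {Ω : Type} [MeasurableSpace Ω]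
    (ν : Measure Ω) (a : G → Ω → Ω) (D : Set Ω) : Prop :=
  MeasurableSet D ∧ (∀ᵐ x ∂ν, ∃ g : G, a g x ∈ D) ∧
    ∀ g : G, g ≠ 1 → ν (D ∩ a g ⁻¹' D) = 0

/-- A measure equivalence coupling between `G` and `H`: a standard σ-finite measure space
with commuting measure-preserving essentially free actions of `G` and `H`, each admitting
a Borel fundamental domain of finite positive measure. -/
structure MECoupling (G : Type) [Group G] (H : Type) [Group H] where
  (Ω : Type)
  [mΩ : MeasurableSpace Ω]
  [sbΩ : StandardBorelSpace Ω]
  (ν : Measure Ω)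
  sigmaFinite : SigmaFinite ν
  aG : G → Ω → Ω
  aH : H → Ω → Ω
  DG : Set Ω
  DH : Set Ω
  aG_one : ∀ x, aG 1 x = x
  aG_mul : ∀ g g' x, aG (g * g') x = aG g (aG g' x)
  aH_one : ∀ x, aH 1 x = x
  aH_mul : ∀ h h' x, aH (h * h') x = aH h (aH h' x)
  comm : ∀ g h x, aG g (aH h x) = aH h (aG g x)
  mp_aG : ∀ g, MeasurePreserving (aG g) ν ν
  mp_aH : ∀ h, MeasurePreserving (aH h) ν ν
  free_aG : ∀ᵐ x ∂ν, ∀ g, aG g x = x → g = 1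
  free_aH : ∀ᵐ x ∂ν, ∀ h, aH h x = x → h = 1
  fund_DG : IsFundamentalDomainFor ν aG DG
  fund_DH : IsFundamentalDomainFor ν aH DH
  DG_pos : 0 < ν DG
  DG_fin : ν DG < ⊤
  DH_pos : 0 < ν DH
  DH_fin : ν DH < ⊤

/-- The generalized index (compression constant) of a measure equivalence coupling. -/
noncomputable def MECoupling.index {G : Type} [Group G] {H : Type} [Group H]
    (c : MECoupling G H) : ENNReal :=
  c.ν c.DH / c.ν c.DG

/-- Measure equivalence of countable groups. -/
def MeasureEquivalent (G : Type) [Group G] (H : Type) [Group H] : Prop :=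
  Nonempty (MECoupling G H)

/-- Measure equivalence with a prescribed generalized index. -/
def MEwithIndex (G : Type) [Group G] (H : Type) [Group H] (κ : ENNReal) : Prop :=
  ∃ c : MECoupling G H, c.index = κ

section Selection

open Filter Topology

lemma isCompact_box (k : ℕ → ℕ) : IsCompact {s : ℕ → ℕ | ∀ i, s i ≤ k i} := by
  have := isCompact_univ_pi (s := fun i => Set.Iic (k i))
    (fun i => (Set.finite_Iic (k i)).isCompact)
  convert this using 1
  ext s; simp [Pi.le_def]

/-- An open neighbourhood of the compact box `∏ [0, k i]` in the Baire space contains one of the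
boxes constraining only finitely many coordinates. -/
lemma exists_finite_box_subset (k : ℕ → ℕ) {O : Set (ℕ → ℕ)} (hO : IsOpen O)
    (hK : {s : ℕ → ℕ | ∀ i, s i ≤ k i} ⊆ O) :
    ∃ n, {s : ℕ → ℕ | ∀ i < n, s i ≤ k i} ⊆ O := by
  by_contra! hcon
  have hex : ∀ n, ∃ s : ℕ → ℕ, (∀ i < n, s i ≤ k i) ∧ s ∉ O := by
    intro n
    obtain ⟨s, hs, hsO⟩ := Set.not_subset.1 (hcon n)
    exact ⟨s, hs, hsO⟩
  choose s hs hsO using hex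
  have hcomp := isCompact_box k
  obtain ⟨t, ht, φ, hφ, hlim⟩ := hcomp.tendsto_subseq
    (x := fun n i => min (s n i) (k i)) (fun n i => min_le_right _ _)
  have hlim' : Tendsto (s ∘ φ) atTop (𝓝 t) := by
    rw [tendsto_pi_nhds] at hlim ⊢
    intro i
    refine (hlim i).congr' ?_
    filter_upwards [eventually_gt_atTop i] with n hn
    exact min_eq_left (hs (φ n) i (lt_of_lt_of_le hn (hφ.id_le n)))
  obtain ⟨n, hn⟩ := (hlim'.eventually (hO.mem_nhds (hK ht))).exists
  exact hsO _ hn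

variable {X : Type} [MeasurableSpace X] [TopologicalSpace X] [PolishSpace X] [BorelSpace X]

/-- Inner approximation of the range of a continuous map on the Baire space by compact images. -/
lemma exists_isCompact_le_measure_image (μ : Measure X) [IsFiniteMeasure μ]
    {g : (ℕ → ℕ) → X} (hg : Continuous g) {c : ENNReal} (hc : c < μ (Set.range g)) :
    ∃ K : Set (ℕ → ℕ), IsCompact K ∧ c ≤ μ (g '' K) := by
  have step : ∀ (n : ℕ) (B : Set (ℕ → ℕ)), c < μ (g '' B) →
      ∃ a : ℕ, c < μ (g '' (B ∩ {s | s n ≤ a})) := by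
    intro n B hB
    have hmono : Monotone fun a : ℕ => g '' (B ∩ {s | s n ≤ a}) := by
      intro a b hab
      refine Set.image_mono (Set.inter_subset_inter_right _ ?_)
      intro s hs
      exact le_trans hs hab
    have hU : (⋃ a : ℕ, g '' (B ∩ {s | s n ≤ a})) = g '' B := by
      rw [← Set.image_iUnion, ← Set.inter_iUnion]
      congr 1
      refine Set.inter_eq_left.2 fun s _ => Set.mem_iUnion.2 ⟨s n, le_refl (s n)⟩
    rw [← hU, hmono.measure_iUnion] at hB
    exact lt_iSup_iff.1 hB
  choose a ha using step
  let B : ℕ → {B : Set (ℕ → ℕ) // c < μ (g '' B)} := fun n =>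
    Nat.rec ⟨Set.univ, by rwa [Set.image_univ]⟩
      (fun n B => ⟨B.1 ∩ {s | s n ≤ a n B.1 B.2}, ha n B.1 B.2⟩) n
  let k : ℕ → ℕ := fun n => a n (B n).1 (B n).2
  have hB : ∀ n, (B n).1 = {s : ℕ → ℕ | ∀ i < n, s i ≤ k i} := by
    intro n
    induction n with
    | zero => ext s; simp [B]
    | succ n ih =>
      have : (B (n + 1)).1 = (B n).1 ∩ {s | s n ≤ k n} := rfl
      rw [this, ih]
      ext s
      simp only [Set.mem_inter_iff, Set.mem_ofPred_eq, Nat.lt_succ_iff_lt_or_eq]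
      constructor
      · rintro ⟨h1, h2⟩ i (hi | rfl)
        exacts [h1 i hi, h2]
      · intro h
        exact ⟨fun i hi => h i (Or.inl hi), h n (Or.inr rfl)⟩
  have hcomp := isCompact_box k
  refine ⟨_, hcomp, ?_⟩
  have hsub : (⋂ n, closure (g '' (B n).1)) ⊆ g '' {s : ℕ → ℕ | ∀ i, s i ≤ k i} := by
    intro x hx
    by_contra hxK
    obtain ⟨U, V, hU, hV, hKU, hxV, hUV⟩ := SeparatedNhds.of_isCompact_isCompact
      (hcomp.image hg) (isCompact_singleton (x := x)) (Set.disjoint_singleton_right.2 hxK)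
    obtain ⟨n, hn⟩ := exists_finite_box_subset k (hU.preimage hg) (Set.image_subset_iff.1 hKU)
    rw [← hB n] at hn
    obtain ⟨y, hyV, hyB⟩ := mem_closure_iff.1 (Set.mem_iInter.1 hx n) V hV (hxV rfl)
    exact Set.disjoint_left.1 hUV (Set.image_subset_iff.2 hn hyB) hyV
  refine le_trans ?_ (measure_mono hsub)
  have hanti : Antitone fun n => closure (g '' (B n).1) := by
    intro m n hmn
    refine closure_mono (Set.image_mono ?_)
    rw [hB, hB]
    intro s hs i hi
    exact hs i (hi.trans_le hmn)
  rw [hanti.measure_iInter (fun n => isClosed_closure.measurableSet.nullMeasurableSet)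
    ⟨0, measure_ne_top _ _⟩]
  exact le_iInf fun n => (B n).2.le.trans (measure_mono subset_closure)

/-- Analytic sets are universally measurable. -/
lemma MeasureTheory.AnalyticSet.nullMeasurableSet {A : Set X} (hA : AnalyticSet A)
    (μ : Measure X) [IsFiniteMeasure μ] : NullMeasurableSet A μ := by
  rw [AnalyticSet] at hA
  rcases hA with rfl | ⟨g, hg, rfl⟩
  · exact MeasurableSet.empty.nullMeasurableSet
  rcases eq_or_ne (μ (Set.range g)) 0 with h0 | h0
  · exact NullMeasurableSet.of_null h0
  obtain ⟨c, -, hc, hclim⟩ := exists_seq_strictMono_tendsto' (pos_iff_ne_zero.2 h0)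
  choose K hK hcK using fun n => exists_isCompact_le_measure_image μ hg (hc n).2
  have hT : MeasurableSet (⋃ n, g '' K n) :=
    MeasurableSet.iUnion fun n => ((hK n).image hg).isClosed.measurableSet
  have hsub : (⋃ n, g '' K n) ⊆ Set.range g :=
    Set.iUnion_subset fun n => Set.image_subset_range _ _
  have hle : μ (Set.range g) ≤ μ (⋃ n, g '' K n) :=
    le_of_tendsto' hclim fun n => (hcK n).trans (measure_mono (Set.subset_iUnion (fun n => g '' K n) n))
  exact ⟨_, hT, (ae_eq_of_subset_of_measure_ge hsub hle hT.nullMeasurableSet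
    (measure_ne_top _ _)).symm⟩

/-- Measurable selection: a Borel set with nonnull projection contains the graph of a Borel map
defined on a nonnull Borel set. -/
lemma exists_measurable_selection (μ : Measure X) [IsFiniteMeasure μ] {P : Set (X × X)}
    (hP : MeasurableSet P) (hpos : μ (Prod.fst '' P) ≠ 0) :
    ∃ (B : Set X) (f : X → X), MeasurableSet B ∧ Measurable f ∧ μ B ≠ 0 ∧
      ∀ x ∈ B, (x, f x) ∈ P := by
  have hPa := hP.analyticSet
  rw [AnalyticSet] at hPa
  rcases hPa with rfl | ⟨q, hq, rfl⟩
  · simp at hpos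
  have hg : Continuous (Prod.fst ∘ q) := continuous_fst.comp hq
  rw [← Set.range_comp] at hpos
  obtain ⟨c, hc0, hc⟩ := exists_between (pos_iff_ne_zero.2 hpos)
  obtain ⟨K, hK, hcK⟩ := exists_isCompact_le_measure_image μ hg hc
  have hne : K.Nonempty := by
    by_contra h
    rw [Set.not_nonempty_iff_eq_empty] at h
    simp [h] at hcK
    exact hc0.ne' hcK
  have : Nonempty K := hne.to_subtype
  have : CompactSpace K := isCompact_iff_compactSpace.1 hK
  let : MetricSpace K := TopologicalSpace.metrizableSpaceMetric K
  obtain ⟨ψ, hψ, hψs⟩ := exists_nat_bool_continuous_surjective_of_compact K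
  let r : cantorSet → X × X := fun t => q (ψ (cantorSetHomeomorphNatToBool t)).1
  have hr : Continuous r :=
    hq.comp (continuous_subtype_val.comp (hψ.comp cantorSetHomeomorphNatToBool.continuous))
  have hrs : Set.range (Prod.fst ∘ r) = (Prod.fst ∘ q) '' K := by
    ext x
    constructor
    · rintro ⟨t, rfl⟩
      exact ⟨_, (ψ (cantorSetHomeomorphNatToBool t)).2, rfl⟩
    · rintro ⟨s, hs, rfl⟩
      obtain ⟨b, hb⟩ := hψs ⟨s, hs⟩
      refine ⟨cantorSetHomeomorphNatToBool.symm b, ?_⟩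
      simp [r, hb]
  have : CompactSpace cantorSet := isCompact_iff_compactSpace.1 isCompact_cantorSet
  have himg : ∀ F : Set cantorSet, IsClosed F → MeasurableSet ((Prod.fst ∘ r) '' F) := fun F hF =>
    (hF.isCompact.image (continuous_fst.comp hr)).isClosed.measurableSet
  let T : X → Set ℝ := fun x => Subtype.val '' {t : cantorSet | (r t).1 = x}
  let h : X → ℝ := fun x => sInf (T x)
  have hTc : ∀ x, IsCompact (T x) := fun x =>
    ((isClosed_singleton.preimage (continuous_fst.comp hr)).isCompact (s :=
      (Prod.fst ∘ r) ⁻¹' {x})).image continuous_subtype_val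
  have hmem : ∀ x ∈ (Prod.fst ∘ q) '' K, h x ∈ T x := by
    intro x hx
    rw [← hrs] at hx
    obtain ⟨t, ht⟩ := hx
    exact (hTc x).sInf_mem ⟨t, t, ht, rfl⟩
  have hh : Measurable h := by
    refine measurable_of_Iic fun b => ?_
    have hB : MeasurableSet ((Prod.fst ∘ q) '' K) := (hK.image hg).isClosed.measurableSet
    have : h ⁻¹' Set.Iic b = ((Prod.fst ∘ r) '' {t : cantorSet | (t : ℝ) ≤ b}) ∪
        (((Prod.fst ∘ q) '' K)ᶜ ∩ {_x : X | (0 : ℝ) ≤ b}) := by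
      ext x
      by_cases hx : x ∈ (Prod.fst ∘ q) '' K
      · have h1 : x ∉ ((Prod.fst ∘ q) '' K)ᶜ ∩ {_x : X | (0 : ℝ) ≤ b} := fun h' => h'.1 hx
        rw [Set.mem_union, or_iff_left h1]
        constructor
        · intro hb
          obtain ⟨t, ht, hth⟩ := hmem x hx
          exact ⟨t, show (t : ℝ) ≤ b from hth ▸ hb, ht⟩
        · rintro ⟨t, ht, rfl⟩
          exact (csInf_le (hTc _).bddBelow ⟨t, rfl, rfl⟩).trans ht
      · have h1 : x ∉ (Prod.fst ∘ r) '' {t : cantorSet | (t : ℝ) ≤ b} := fun h' =>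
          hx (hrs ▸ Set.image_subset_range _ _ h')
        have h2 : T x = ∅ := by
          rw [Set.eq_empty_iff_forall_notMem]
          rintro _ ⟨t, ht, rfl⟩
          exact hx (hrs ▸ ⟨t, ht⟩)
        rw [Set.mem_union, or_iff_right h1]
        simp only [Set.mem_preimage, h, h2, Real.sInf_empty, Set.mem_Iic, Set.mem_inter_iff]
        exact ⟨fun hb => ⟨hx, hb⟩, fun hb => hb.2⟩
    rw [this]
    refine (himg _ ?_).union (hB.compl.inter (MeasurableSet.const _))
    exact isClosed_le continuous_subtype_val continuous_const
  have hcm : MeasurableSet cantorSet := isClosed_cantorSet.measurableSet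
  let r' : ℝ → X := Function.extend Subtype.val (fun t : cantorSet => (r t).2)
    (fun _ => (q 0).2)
  have hr' : Measurable r' := (MeasurableEmbedding.subtype_coe hcm).measurable_extend
    (continuous_snd.comp hr).measurable measurable_const
  refine ⟨_, r' ∘ h, (hK.image hg).isClosed.measurableSet, hr'.comp hh,
    (hc0.trans_le hcK).ne', fun x hx => ?_⟩
  obtain ⟨t, ht, hth⟩ := hmem x hx
  have : r' (h x) = (r t).2 := by
    rw [← hth]
    exact Subtype.val_injective.extend_apply _ _ _
  refine ⟨(ψ (cantorSetHomeomorphNatToBool t)).1, ?_⟩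
  rw [Function.comp_apply, this]
  exact Prod.ext ht rfl

end Selection

section Measure

variable {X : Type} [MeasurableSpace X]

lemma CBER.IsPMP.measure_image [StandardBorelSpace X] {μ : Measure X} {R : CBER X}
    (h : R.IsPMP μ) {f : X → X} (hf : Measurable f) {A : Set X} (hA : MeasurableSet A)
    (hrel : ∀ x ∈ A, R.rel x (f x)) (hinj : Set.InjOn f A) : μ (f '' A) = μ A := by
  have : StandardBorelSpace A := hA.standardBorel
  have hemb : MeasurableEmbedding (A.domRestrict f) :=
    (hf.comp measurable_subtype_coe).measurableEmbedding (Set.injOn_iff_injective.1 hinj)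
  have hext : ∀ x ∈ A, Function.extend (A.domRestrict f) Subtype.val id (f x) = x := fun x hx =>
    hemb.injective.extend_apply Subtype.val id ⟨x, hx⟩
  refine h
    { src := A, tgt := f '' A, src_meas := hA
      tgt_meas := hA.image_of_measurable_injOn hf hinj
      toFun := f
      invFun := Function.extend (A.domRestrict f) Subtype.val id
      meas_toFun := hf
      meas_invFun := hemb.measurable_extend measurable_subtype_coe measurable_id
      mapsTo := Set.mapsTo_image f A
      mapsTo_inv := ?_
      left_inv := hext
      right_inv := ?_ } ⟨fun x hx => (R.rel_dom (hrel x hx)).1, hrel⟩ A subset_rfl hA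
  · rintro _ ⟨x, hx, rfl⟩
    rwa [hext x hx]
  · rintro _ ⟨x, hx, rfl⟩
    rw [hext x hx]

/-- A Borel map with countable fibres on `B` is injective on the pieces of a countable Borel
cover of almost all of `B`. -/
lemma exists_injOn_cover [TopologicalSpace X] [PolishSpace X] [BorelSpace X]
    (μ : Measure X) [IsFiniteMeasure μ] {f : X → X} (hf : Measurable f) {B : Set X}
    (hB : MeasurableSet B) (hc : ∀ y, (B ∩ f ⁻¹' {y}).Countable) :
    ∃ A : ℕ → Set X, (∀ n, MeasurableSet (A n)) ∧ (∀ n, A n ⊆ B) ∧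
      (∀ n, Set.InjOn f (A n)) ∧ μ (B \ ⋃ n, A n) = 0 := by
  rcases isEmpty_or_nonempty X with hX | hX
  · exact ⟨fun _ => ∅, fun _ => .empty, by simp, by simp, by simp [Set.eq_empty_of_isEmpty]⟩
  have hpair : Measurable fun x => (f x, x) := hf.prodMk measurable_id
  let ρ : Measure (X × X) := (μ.restrict B).map fun x => (f x, x)
  let κ := ρ.condKernel
  have hρ : ρ.fst.compProd κ = ρ := ρ.disintegrate _
  let G : X × X → ENNReal := fun p => κ p.1 {p.2}
  have hG : Measurable G := by
    have ht : MeasurableSet {q : (X × X) × X | q.2 = q.1.2} :=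
      measurableSet_eq_fun measurable_snd (measurable_snd.comp measurable_fst)
    have := ProbabilityTheory.Kernel.measurable_kernel_prodMk_left
      (κ := κ.comap Prod.fst measurable_fst) ht
    exact this
  have hconc : ∀ᵐ y ∂ρ.fst, ∀ᵐ x ∂κ y, x ∈ B ∧ f x = y := by
    refine Measure.ae_ae_of_ae_compProd (p := fun q : X × X => q.2 ∈ B ∧ f q.2 = q.1) ?_
    rw [hρ]
    have hm : MeasurableSet {q : X × X | q.2 ∈ B ∧ f q.2 = q.1} :=
      (measurable_snd hB).inter (measurableSet_eq_fun (hf.comp measurable_snd) measurable_fst)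
    rw [ae_map_iff hpair.aemeasurable hm, ae_restrict_iff' hB]
    exact ae_of_all _ fun x hx => ⟨hx, rfl⟩
  have hpos : ∀ᵐ q ∂ρ, G q ≠ 0 := by
    rw [← hρ]
    refine Measure.ae_compProd_of_ae_ae (hG (measurableSet_singleton 0).compl) ?_
    filter_upwards [hconc] with y hy
    have h0 : κ y {x | x ∈ B ∩ f ⁻¹' {y} ∧ G (y, x) = 0} = 0 := by
      refine (measure_null_iff_singleton ((hc y).mono fun x hx => hx.1)).2 ?_
      exact fun x hx => hx.2
    have h1 : ∀ᵐ x ∂κ y, x ∉ {x | x ∈ B ∩ f ⁻¹' {y} ∧ G (y, x) = 0} :=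
      measure_eq_zero_iff_ae_notMem.1 h0
    filter_upwards [hy, h1] with x hx hx' h
    exact hx' ⟨hx, h⟩
  have hpos' : ∀ᵐ x ∂μ, x ∈ B → G (f x, x) ≠ 0 := by
    rw [← ae_restrict_iff' hB]
    exact ae_of_ae_map hpair.aemeasurable hpos
  have hbas := TopologicalSpace.isBasis_countableBasis X
  obtain ⟨b, hb⟩ := (TopologicalSpace.countable_countableBasis X).exists_eq_range
    (by
      obtain ⟨v, hv, -⟩ := hbas.exists_subset_of_mem_open (Set.mem_univ hX.some) isOpen_univ
      exact ⟨v, hv⟩)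
  rw [hb] at hbas
  have hbo : ∀ n, IsOpen (b n) := fun n => hbas.isOpen ⟨n, rfl⟩
  refine ⟨fun n => {x | x ∈ B ∩ b n ∧ κ (f x) (b n) < 2 * G (f x, x)}, fun n => ?_, fun n x hx =>
    hx.1.1, fun n x hx x' hx' hxx => ?_, ?_⟩
  · exact (hB.inter (hbo n).measurableSet).inter (measurableSet_lt
      ((κ.measurable_coe (hbo n).measurableSet).comp hf) ((hG.comp hpair).const_mul 2))
  · by_contra hne
    have hle : κ (f x) {x} + κ (f x) {x'} ≤ κ (f x) (b n) := by
      rw [← measure_union (by simpa using hne) (measurableSet_singleton _)]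
      exact measure_mono (Set.union_subset (Set.singleton_subset_iff.2 hx.1.2)
        (Set.singleton_subset_iff.2 hx'.1.2))
    have h1 := hx.2
    have h2 := hx'.2
    rw [← hxx] at h2
    have h3 := ENNReal.add_lt_add h1 h2
    rw [← mul_add, ← two_mul] at h3
    exact absurd (lt_of_lt_of_le h3 (mul_le_mul_right hle 2)) (lt_irrefl _)
  · rw [measure_eq_zero_iff_ae_notMem]
    filter_upwards [hpos'] with x hx hxB
    refine hxB.2 ?_
    have hne := hx hxB.1
    have hlt : κ (f x) {x} < 2 * κ (f x) {x} := by
      rw [two_mul]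
      exact ENNReal.lt_add_right (measure_ne_top _ _) hne
    obtain ⟨O, hxO, hO, hOlt⟩ := Set.exists_isOpen_lt_of_lt _ _ hlt
    obtain ⟨_, ⟨n, rfl⟩, hxn, hnO⟩ := hbas.exists_subset_of_mem_open
      (hxO rfl) hO
    exact Set.mem_iUnion.2 ⟨n, ⟨hxB.1, hxn⟩, (measure_mono hnO).trans_lt hOlt⟩

variable [TopologicalSpace X] [PolishSpace X] [BorelSpace X]

/-- Saturations of null sets are null. -/
lemma CBER.IsPMP.measure_sat_eq_zero {μ : Measure X} [IsFiniteMeasure μ] {R : CBER X}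
    (h : R.IsPMP μ) {N : Set X} (hN : μ N = 0) : μ (R.sat N) = 0 := by
  have hP : MeasurableSet {p : X × X | R.rel p.1 p.2 ∧ p.2 ∈ toMeasurable μ N} :=
    R.rel_meas.inter (measurable_snd (measurableSet_toMeasurable μ N))
  by_contra hne
  have hpos : μ (Prod.fst '' {p : X × X | R.rel p.1 p.2 ∧ p.2 ∈ toMeasurable μ N}) ≠ 0 := by
    intro h0
    refine hne (measure_mono_null ?_ h0)
    rintro y ⟨x, hx, hxy⟩
    exact ⟨(y, x), ⟨R.symm hxy, subset_toMeasurable μ N hx⟩, rfl⟩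
  obtain ⟨B, f, hB, hf, hB0, hBP⟩ := exists_measurable_selection μ hP hpos
  obtain ⟨A, hA, hAB, hAinj, hA0⟩ := exists_injOn_cover μ hf hB fun y =>
    (R.countable_classes y).mono fun x hx => by
      have := (hBP x hx.1).1
      rw [show f x = y from hx.2] at this
      exact R.symm this
  refine hB0 (measure_mono_null (Set.subset_sdiff_union B (⋃ n, A n))
    (measure_union_null hA0 ?_))
  refine measure_iUnion_null fun n => ?_
  rw [← h.measure_image hf (hA n) (fun x hx => (hBP x (hAB n hx)).1) (hAinj n)]
  refine measure_mono_null ?_ ((measure_toMeasurable N).trans hN)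
  rintro _ ⟨x, hx, rfl⟩
  exact (hBP x (hAB n hx)).2

lemma CBER.IsPMP.ae_forall_rel {μ : Measure X} [IsFiniteMeasure μ] {R : CBER X}
    (h : R.IsPMP μ) {p : X → Prop} (hp : ∀ᵐ x ∂μ, p x) :
    ∀ᵐ x ∂μ, ∀ y, R.rel x y → p y := by
  refine measure_mono_null ?_ (h.measure_sat_eq_zero hp)
  intro x hx
  simp only [Set.mem_compl_iff, Set.mem_ofPred_eq, not_forall] at hx
  obtain ⟨y, hxy, hy⟩ := hx
  exact ⟨y, hy, R.symm hxy⟩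

/-- A null-measurable partial transversal of an aperiodic p.m.p. relation is null. -/
lemma CBER.IsPMP.measure_transversal_eq_zero {μ : Measure X} [IsFiniteMeasure μ] {R : CBER X}
    (h : R.IsPMP μ) (hap : R.Aperiodic) {F : Set X} (hF : NullMeasurableSet F μ)
    (hdom : F ⊆ R.dom) (hinj : ∀ x ∈ F, ∀ y ∈ F, R.rel x y → x = y) : μ F = 0 := by
  wlog hFm : MeasurableSet F generalizing F
  · obtain ⟨F', hF'F, hF', hae⟩ := hF.exists_measurable_subset_ae_eq
    rw [← measure_congr hae]
    exact this hF'.nullMeasurableSet (hF'F.trans hdom)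
      (fun x hx y hy => hinj x (hF'F hx) y (hF'F hy)) hF'
  let P : Set (X × X) := {p | p.1 ∈ F ∧ R.rel p.1 p.2}
  have hP : MeasurableSet P := (measurable_fst hFm).inter R.rel_meas
  have hsnd : Set.InjOn Prod.snd P := by
    rintro ⟨x, y⟩ ⟨hx, hxy⟩ ⟨x', y'⟩ ⟨hx', hxy'⟩ (rfl : y = y')
    rw [hinj x hx x' hx' (R.trans hxy (R.symm hxy'))]
  have : StandardBorelSpace P := hP.standardBorel
  have hemb : MeasurableEmbedding (P.domRestrict Prod.snd) :=
    (measurable_snd.comp measurable_subtype_coe).measurableEmbedding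
      (Set.injOn_iff_injective.1 hsnd)
  let π : X → X := Function.extend (P.domRestrict Prod.snd) (fun p => p.1.1) id
  have hπ : Measurable π :=
    hemb.measurable_extend (measurable_fst.comp measurable_subtype_coe) measurable_id
  have hπP : ∀ x y, (x, y) ∈ P → π y = x := fun x y hxy =>
    hemb.injective.extend_apply (fun p : P => p.1.1) id ⟨(x, y), hxy⟩
  have hY : MeasurableSet (Prod.snd '' P) := hP.image_of_measurable_injOn measurable_snd hsnd
  have hπrel : ∀ y ∈ Prod.snd '' P, R.rel y (π y) := by
    rintro _ ⟨⟨x, y⟩, hxy, rfl⟩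
    rw [hπP x y hxy]
    exact R.symm hxy.2
  obtain ⟨A, hA, hAY, hAinj, hA0⟩ := exists_injOn_cover μ hπ hY fun x =>
    (R.countable_classes x).mono fun y hy => by
      have := R.symm (hπrel y hy.1)
      rwa [show π y = x from hy.2] at this
  have hDA : ∀ n, disjointed A n ⊆ A n := disjointed_subset A
  have hD : ∀ n, MeasurableSet (disjointed A n) := fun n => MeasurableSet.disjointed hA n
  have hμD : ∀ n, μ (π '' disjointed A n) = μ (disjointed A n) := fun n =>
    h.measure_image hπ (hD n) (fun y hy => hπrel y (hAY n (hDA n hy)))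
      ((hAinj n).mono (hDA n))
  have hBC : μ {x | ∃ᶠ n in Filter.atTop, x ∈ π '' disjointed A n} = 0 := by
    refine measure_setOfPred_frequently_eq_zero ?_
    have : ∑' n, μ (π '' disjointed A n) = μ (⋃ n, disjointed A n) := by
      rw [measure_iUnion (disjoint_disjointed A) hD]
      exact tsum_congr hμD
    exact this ▸ measure_ne_top _ _
  refine measure_mono_null ?_ (measure_union_null (h.measure_sat_eq_zero hA0) hBC)
  intro x hx
  by_contra hcon
  rw [Set.mem_union, not_or] at hcon
  obtain ⟨hxN, hxfr⟩ := hcon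
  have hfin : {n | x ∈ π '' disjointed A n}.Finite := by
    by_contra hinf
    exact hxfr (Nat.frequently_atTop_iff_infinite.2 hinf)
  refine hap x (hdom hx) (Set.Finite.subset (hfin.biUnion fun n _ =>
    (Set.Subsingleton.finite (s := disjointed A n ∩ π ⁻¹' {x}) ?_)) ?_)
  · rintro y ⟨hy, hyx⟩ z ⟨hz, hzx⟩
    exact hAinj n (hDA n hy) (hDA n hz) (Eq.trans hyx (Eq.symm hzx))
  · intro y hxy
    have hxyP : (x, y) ∈ P := ⟨hx, hxy⟩
    have hyA : y ∈ ⋃ n, A n := by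
      by_contra hyA
      exact hxN ⟨y, ⟨⟨_, hxyP, rfl⟩, hyA⟩, R.symm hxy⟩
    rw [← iUnion_disjointed] at hyA
    obtain ⟨n, hn⟩ := Set.mem_iUnion.1 hyA
    exact Set.mem_biUnion (show n ∈ {n | x ∈ π '' disjointed A n} from ⟨y, hn, hπP x y hxyP⟩)
      ⟨hn, hπP x y hxyP⟩

end Measure

section Paths

variable {X : Type} [MeasurableSpace X] {ι : Type}

/-- `PathRel Rf l x y`: there is a path from `x` to `y` with nontrivial steps whose successive
labels, the factors containing the steps, are listed by `l`. -/
def PathRel (Rf : ι → CBER X) : List ι → X → X → Prop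
  | [], x, y => x = y
  | i :: l, x, y => ∃ z, x ≠ z ∧ (Rf i).rel x z ∧ PathRel Rf l z y

/-- `ReducedRel Rf J x y`: some reduced path from `x` to `y` has all its labels in `J`. -/
def ReducedRel (Rf : ι → CBER X) (J : Set ι) (x y : X) : Prop :=
  ∃ l : List ι, l.IsChain (· ≠ ·) ∧ (∀ i ∈ l, i ∈ J) ∧ PathRel Rf l x y

variable {Rf : ι → CBER X}

lemma pathRel_append {l m : List ι} {x y : X} :
    PathRel Rf (l ++ m) x y ↔ ∃ z, PathRel Rf l x z ∧ PathRel Rf m z y := by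
  induction l generalizing x with
  | nil => simp [PathRel]
  | cons i l ih =>
    simp only [List.cons_append, PathRel, ih]
    constructor
    · rintro ⟨z, h1, h2, w, h3, h4⟩
      exact ⟨w, ⟨z, h1, h2, h3⟩, h4⟩
    · rintro ⟨w, ⟨z, h1, h2, h3⟩, h4⟩
      exact ⟨z, h1, h2, w, h3, h4⟩

lemma PathRel.append {l m : List ι} {x y z : X} (h : PathRel Rf l x y)
    (h' : PathRel Rf m y z) : PathRel Rf (l ++ m) x z :=
  pathRel_append.2 ⟨y, h, h'⟩

lemma PathRel.reverse {l : List ι} {x y : X} (h : PathRel Rf l x y) :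
    PathRel Rf l.reverse y x := by
  induction l generalizing x with
  | nil => exact Eq.symm h
  | cons i l ih =>
    obtain ⟨z, hxz, hR, h⟩ := h
    rw [List.reverse_cons]
    exact (ih h).append ⟨x, hxz.symm, (Rf i).symm hR, rfl⟩

lemma PathRel.exists_points {l : List ι} {x y : X} (h : PathRel Rf l x y) :
    ∃ f : ℕ → X, f 0 = x ∧ f l.length = y ∧
      ∀ j (hj : j < l.length), f j ≠ f (j + 1) ∧ (Rf l[j]).rel (f j) (f (j + 1)) := by
  induction l generalizing x with
  | nil => exact ⟨fun _ => x, rfl, h, by simp⟩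
  | cons i l ih =>
    obtain ⟨z, hxz, hR, h⟩ := h
    obtain ⟨f, hf0, hfl, hf⟩ := ih h
    refine ⟨fun n => Nat.casesOn n x f, rfl, hfl, fun j hj => ?_⟩
    cases j with
    | zero => exact ⟨by simpa [hf0] using hxz, by simpa [hf0] using hR⟩
    | succ j => exact hf j (by simpa using hj)

lemma FreelyIndep.not_pathRel_self (hfi : FreelyIndep Rf) {l : List ι} (hl : l ≠ [])
    (hc : l.IsChain (· ≠ ·)) (x : X) : ¬ PathRel Rf l x x := by
  intro h
  obtain ⟨f, hf0, hfl, hf⟩ := h.exists_points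
  have hpos : 0 < l.length := List.length_pos_iff.2 hl
  have hlen : 2 ≤ l.length := by
    by_contra hlt
    have h1 : l.length = 1 := by omega
    refine (hf 0 hpos).1 ?_
    rw [hf0, show (0 + 1) = l.length from h1.symm, hfl]
  obtain ⟨j, hj, hjj⟩ := hfi l.length f (fun j => l.getD j (l.head hl)) hlen (hfl.trans hf0.symm)
    (fun j hj => (hf j hj).1) (fun j hj => by
      simpa [List.getD_eq_getElem?_getD, hj] using (hf j hj).2)
  have := List.isChain_iff_getElem.1 hc j hj
  refine this ?_
  simpa [List.getD_eq_getElem?_getD, hj, Nat.lt_of_succ_lt hj] using hjj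

lemma List.IsChain.reverse_append_of_head?_ne {l m : List ι} (hl : l.IsChain (· ≠ ·))
    (hm : m.IsChain (· ≠ ·)) (h : ∀ a ∈ l.head?, ∀ b ∈ m.head?, a ≠ b) :
    (l.reverse ++ m).IsChain (· ≠ ·) := by
  refine List.IsChain.append ?_ hm ?_
  · rw [List.isChain_reverse]
    exact hl.imp fun _ _ => Ne.symm
  · simpa using h

lemma FreelyIndep.step_unique (hfi : FreelyIndep Rf) {i j : ι} {l m : List ι} {x y z w : X}
    (hl : (i :: l).IsChain (· ≠ ·)) (hm : (j :: m).IsChain (· ≠ ·))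
    (hxz : x ≠ z) (hz : (Rf i).rel x z) (hzy : PathRel Rf l z y)
    (hxw : x ≠ w) (hw : (Rf j).rel x w) (hwy : PathRel Rf m w y) : i = j ∧ z = w := by
  have hl' : PathRel Rf (i :: l) x y := ⟨z, hxz, hz, hzy⟩
  have hm' : PathRel Rf (j :: m) x y := ⟨w, hxw, hw, hwy⟩
  have hij : i = j := by
    by_contra hij
    refine hfi.not_pathRel_self (l := (i :: l).reverse ++ (j :: m)) (by simp)
      (hl.reverse_append_of_head?_ne hm ?_) y (hl'.reverse.append hm')
    simpa using hij
  subst hij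
  refine ⟨rfl, ?_⟩
  by_contra hzw
  refine hfi.not_pathRel_self (l := l.reverse ++ (i :: m)) (by simp)
    (hl.tail.reverse_append_of_head?_ne hm ?_) y
    (hzy.reverse.append ⟨w, hzw, (Rf i).trans ((Rf i).symm hz) hw, hwy⟩)
  rw [List.isChain_cons] at hl
  simpa using fun a ha => (hl.1 a ha).symm

/-- Two points are joined by at most one reduced path. -/
lemma FreelyIndep.labels_unique (hfi : FreelyIndep Rf) {l m : List ι} {x y : X}
    (hl : l.IsChain (· ≠ ·)) (hm : m.IsChain (· ≠ ·)) (h : PathRel Rf l x y)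
    (h' : PathRel Rf m x y) : l = m := by
  induction l generalizing x m with
  | nil =>
    obtain rfl : x = y := h
    by_contra hne
    exact hfi.not_pathRel_self (Ne.symm hne) hm x h'
  | cons i l ih =>
    cases m with
    | nil =>
      obtain rfl : x = y := h'
      exact absurd h (hfi.not_pathRel_self (by simp) hl x)
    | cons j m =>
      obtain ⟨z, hxz, hz, h⟩ := h
      obtain ⟨w, hxw, hw, h'⟩ := h'
      obtain ⟨rfl, rfl⟩ := hfi.step_unique hl hm hxz hz h hxw hw h'
      have hlm : l = m := ih hl.tail hm.tail h h'
      rw [hlm]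

lemma ReducedRel.refl (J : Set ι) (x : X) : ReducedRel Rf J x x :=
  ⟨[], by simp, by simp, rfl⟩

lemma ReducedRel.symm {J : Set ι} {x y : X} (h : ReducedRel Rf J x y) : ReducedRel Rf J y x := by
  obtain ⟨l, hl, hJ, h⟩ := h
  refine ⟨l.reverse, ?_, by simpa using hJ, h.reverse⟩
  simpa using hl.reverse_append_of_head?_ne (m := []) (by simp) (by simp)

lemma ReducedRel.mono {J K : Set ι} (hJK : J ⊆ K) {x y : X} (h : ReducedRel Rf J x y) :
    ReducedRel Rf K x y := by
  obtain ⟨l, hl, hJ, h⟩ := h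
  exact ⟨l, hl, fun i hi => hJK (hJ i hi), h⟩

lemma ReducedRel.head {J : Set ι} {i : ι} (hi : i ∈ J) {x y z : X} (hxy : (Rf i).rel x y)
    (h : ReducedRel Rf J y z) : ReducedRel Rf J x z := by
  by_cases hne : x = y
  · rwa [hne]
  obtain ⟨l, hl, hJ, h⟩ := h
  cases l with
  | nil => exact ⟨[i], by simp, by simpa using hi, y, hne, hxy, h⟩
  | cons j l =>
    by_cases hij : i = j
    · subst hij
      obtain ⟨w, hyw, hw, h⟩ := h
      by_cases hxw : x = w
      · subst hxw
        exact ⟨l, hl.tail, fun k hk => hJ k (List.mem_cons_of_mem _ hk), h⟩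
      · exact ⟨i :: l, hl, hJ, w, hxw, (Rf i).trans hxy hw, h⟩
    · refine ⟨i :: j :: l, by simpa [List.isChain_cons_cons] using ⟨hij, hl⟩, ?_, y, hne, hxy, h⟩
      intro k hk
      rcases List.mem_cons.1 hk with rfl | hk
      exacts [hi, hJ k hk]

lemma ReducedRel.trans {J : Set ι} {x y z : X} (h : ReducedRel Rf J x y)
    (h' : ReducedRel Rf J y z) : ReducedRel Rf J x z := by
  obtain ⟨l, -, hJ, h⟩ := h
  induction l generalizing x with
  | nil =>
    obtain rfl : x = y := h
    exact h'
  | cons i l ih =>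
    obtain ⟨w, -, hw, h⟩ := h
    exact ReducedRel.head (hJ i (by simp)) hw (ih (fun k hk => hJ k (List.mem_cons_of_mem _ hk)) h)

lemma ReducedRel.of_rel {J : Set ι} {i : ι} (hi : i ∈ J) {x y : X} (h : (Rf i).rel x y) :
    ReducedRel Rf J x y :=
  ReducedRel.head hi h (ReducedRel.refl J y)

lemma FreelyIndep.reducedRel_inter (hfi : FreelyIndep Rf) {J K : Set ι} {x y : X}
    (hJ : ReducedRel Rf J x y) (hK : ReducedRel Rf K x y) : ReducedRel Rf (J ∩ K) x y := by
  obtain ⟨l, hl, hlJ, h⟩ := hJ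
  obtain ⟨m, hm, hmK, h'⟩ := hK
  obtain rfl := hfi.labels_unique hl hm h h'
  exact ⟨l, hl, fun i hi => ⟨hlJ i hi, hmK i hi⟩, h⟩

lemma ReducedRel.eq_of_empty {x y : X} (h : ReducedRel Rf ∅ x y) : x = y := by
  obtain ⟨l, -, hJ, h⟩ := h
  cases l with
  | nil => exact h
  | cons i l => exact absurd (hJ i (by simp)) (by simp)

lemma ReducedRel.mem_iUnion_dom {J : Set ι} {x y : X} (h : ReducedRel Rf J x y)
    (hx : x ∈ ⋃ j ∈ J, (Rf j).dom) : y ∈ ⋃ j ∈ J, (Rf j).dom := by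
  obtain ⟨l, -, hJ, h⟩ := h
  induction l generalizing x with
  | nil =>
    obtain rfl : x = y := h
    exact hx
  | cons i l ih =>
    obtain ⟨w, -, hw, h⟩ := h
    exact ih (Set.mem_biUnion (hJ i (by simp)) ((Rf i).rel_dom hw).2)
      (fun k hk => hJ k (List.mem_cons_of_mem _ hk)) h

lemma ReducedRel.rel_of_singleton {i : ι} {x y : X} (h : ReducedRel Rf {i} x y)
    (hx : x ∈ (Rf i).dom) : (Rf i).rel x y := by
  obtain ⟨l, -, hJ, h⟩ := h
  induction l generalizing x with
  | nil =>
    obtain rfl : x = y := h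
    exact (Rf i).refl x hx
  | cons j l ih =>
    obtain ⟨w, -, hw, h⟩ := h
    obtain rfl : j = i := hJ j (by simp)
    exact (Rf j).trans hw (ih ((Rf j).rel_dom hw).2 (fun k hk => hJ k (List.mem_cons_of_mem _ hk)) h)

variable {R : CBER X}

lemma IsFreeProduct.dom_subset (hfp : IsFreeProduct R Rf) (i : ι) : (Rf i).dom ⊆ R.dom := by
  rw [hfp.2.1]
  exact Set.subset_iUnion (fun i => (Rf i).dom) i

lemma IsFreeProduct.rel_of_factor (hfp : IsFreeProduct R Rf) {i : ι} {x y : X}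
    (h : (Rf i).rel x y) : R.rel x y :=
  (hfp.2.2 x y).2 ⟨hfp.dom_subset i ((Rf i).rel_dom h).1, .rel _ _ ⟨i, h⟩⟩

lemma IsFreeProduct.rel_of_pathRel (hfp : IsFreeProduct R Rf) {l : List ι} {x y : X}
    (hx : x ∈ R.dom) (h : PathRel Rf l x y) : R.rel x y := by
  induction l generalizing x with
  | nil =>
    obtain rfl : x = y := h
    exact R.refl x hx
  | cons i l ih =>
    obtain ⟨z, -, hz, h⟩ := h
    have hxz := hfp.rel_of_factor hz
    exact R.trans hxz (ih (R.rel_dom hxz).2 h)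

lemma IsFreeProduct.rel_of_reducedRel (hfp : IsFreeProduct R Rf) {J : Set ι} {x y : X}
    (hx : x ∈ R.dom) (h : ReducedRel Rf J x y) : R.rel x y := by
  obtain ⟨l, -, -, h⟩ := h
  exact hfp.rel_of_pathRel hx h

lemma IsFreeProduct.reducedRel (hfp : IsFreeProduct R Rf) {x y : X} (h : R.rel x y) :
    ReducedRel Rf Set.univ x y := by
  have h' := ((hfp.2.2 x y).1 h).2
  clear h
  induction h' with
  | rel x y h =>
    obtain ⟨i, h⟩ := h
    exact ReducedRel.of_rel (Set.mem_univ i) h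
  | refl x => exact ReducedRel.refl _ x
  | symm x y _ ih => exact ih.symm
  | trans x y z _ _ ih ih' => exact ih.trans ih'

end Paths

section Grouping

lemma MeasureTheory.AnalyticSet.inter {α : Type} [TopologicalSpace α] [T2Space α] {s t : Set α}
    (hs : AnalyticSet s) (ht : AnalyticSet t) : AnalyticSet (s ∩ t) := by
  rw [Set.inter_eq_iInter]
  exact AnalyticSet.iInter fun b => by cases b <;> assumption

lemma MeasureTheory.AnalyticSet.union {α : Type} [TopologicalSpace α] {s t : Set α}
    (hs : AnalyticSet s) (ht : AnalyticSet t) : AnalyticSet (s ∪ t) := by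
  rw [Set.union_eq_iUnion]
  exact AnalyticSet.iUnion fun b => by cases b <;> assumption

/-- Projections of analytic subsets of the plane to the first coordinate. -/
lemma MeasureTheory.AnalyticSet.exists_mem {X : Type} [TopologicalSpace X] [PolishSpace X]
    {r : X → X → Prop}
    (hr : AnalyticSet {p : X × X | r p.1 p.2}) {V : Set X} (hV : AnalyticSet V) :
    AnalyticSet {x | ∃ y ∈ V, r x y} := by
  convert (hr.inter (hV.preimage (f := Prod.snd) continuous_snd)).image_of_continuous
    continuous_fst using 1
  ext x
  constructor
  · rintro ⟨y, hy, h⟩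
    exact ⟨(x, y), ⟨h, hy⟩, rfl⟩
  · rintro ⟨⟨x', y⟩, ⟨h, hy⟩, rfl⟩
    exact ⟨y, hy, h⟩

/-- The complementary index sets `J` and `Jᶜ`, indexed by `Fin 2`. -/
def complPair {ι : Type} (J : Set ι) (k : Fin 2) : Set ι := if k = 0 then J else Jᶜ

lemma complPair_disjoint {ι : Type} (J : Set ι) {k k' : Fin 2} (hk : k ≠ k')
    {i j : ι} (hi : i ∈ complPair J k) (hj : j ∈ complPair J k') : i ≠ j := by
  rintro rfl
  fin_cases k <;> fin_cases k' <;> simp_all [complPair]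

lemma exists_mem_complPair {ι : Type} (J : Set ι) (i : ι) : ∃ k, i ∈ complPair J k := by
  by_cases hi : i ∈ J
  · exact ⟨0, by simpa [complPair] using hi⟩
  · exact ⟨1, by simpa [complPair] using hi⟩

variable {X : Type} [MeasurableSpace X] {ι : Type}
  [TopologicalSpace X] [PolishSpace X] [BorelSpace X] {Rf : ι → CBER X}

lemma analyticSet_pathRel (Rf : ι → CBER X) (l : List ι) :
    AnalyticSet {p : X × X | PathRel Rf l p.1 p.2} := by
  induction l with
  | nil => exact (isClosed_eq continuous_fst continuous_snd).analyticSet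
  | cons i l ih =>
    have hM : MeasurableSet {q : X × X | q.1 ≠ q.2 ∧ (Rf i).rel q.1 q.2} :=
      (measurableSet_eq_fun measurable_fst measurable_snd).compl.inter (Rf i).rel_meas
    have h1 : AnalyticSet {q : X × X × X | q.1 ≠ q.2.1 ∧ (Rf i).rel q.1 q.2.1} :=
      hM.analyticSet.preimage (f := fun q : X × X × X => (q.1, q.2.1)) (by fun_prop)
    have h2 : AnalyticSet {q : X × X × X | PathRel Rf l q.2.1 q.2.2} :=
      ih.preimage (f := fun q : X × X × X => q.2) (by fun_prop)
    convert (h1.inter h2).image_of_continuous (f := fun q : X × X × X => (q.1, q.2.2))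
      (by fun_prop) using 1
    ext ⟨x, y⟩
    constructor
    · rintro ⟨z, hxz, hz, h⟩
      exact ⟨(x, z, y), ⟨⟨hxz, hz⟩, h⟩, rfl⟩
    · rintro ⟨⟨x', z, y'⟩, ⟨⟨hxz, hz⟩, h⟩, heq⟩
      obtain ⟨rfl, rfl⟩ := Prod.mk.inj heq
      exact ⟨z, hxz, hz, h⟩

variable [Countable ι]

lemma analyticSet_exists_pathRel (Rf : ι → CBER X) (P : List ι → Prop) :
    AnalyticSet {p : X × X | ∃ l, P l ∧ PathRel Rf l p.1 p.2} := by
  have : {p : X × X | ∃ l, P l ∧ PathRel Rf l p.1 p.2} =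
      ⋃ l : {l : List ι // P l}, {p : X × X | PathRel Rf l p.1 p.2} := by
    ext p
    simp
  rw [this]
  exact AnalyticSet.iUnion fun l => analyticSet_pathRel Rf l

lemma analyticSet_reducedRel (Rf : ι → CBER X) (J : Set ι) :
    AnalyticSet {p : X × X | ReducedRel Rf J p.1 p.2} := by
  convert analyticSet_exists_pathRel Rf
    (fun l => l.IsChain (· ≠ ·) ∧ ∀ i ∈ l, i ∈ J) using 1
  ext p
  simp [ReducedRel, and_assoc]

/-- The subrelation generated by the factors with index in `J`. -/
def IsFreeProduct.grouped {R : CBER X} (hfp : IsFreeProduct R Rf) (J : Set ι) : CBER X where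
  dom := ⋃ j ∈ J, (Rf j).dom
  dom_meas := MeasurableSet.biUnion J.to_countable fun j _ => (Rf j).dom_meas
  rel x y := x ∈ ⋃ j ∈ J, (Rf j).dom ∧ ReducedRel Rf J x y
  rel_meas := by
    have hdom : MeasurableSet {p : X × X | p.1 ∈ ⋃ j ∈ J, (Rf j).dom} :=
      measurable_fst (MeasurableSet.biUnion J.to_countable fun j _ => (Rf j).dom_meas)
    refine (hdom.analyticSet.inter (analyticSet_reducedRel Rf J)).measurableSet_of_compl ?_
    convert (hdom.compl.analyticSet.union R.rel_meas.compl.analyticSet).union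
      (analyticSet_exists_pathRel Rf (fun l => l.IsChain (· ≠ ·) ∧ ¬ ∀ i ∈ l, i ∈ J)) using 1
    ext ⟨x, y⟩
    constructor
    · intro h
      by_cases hx : (x, y) ∈ {p : X × X | p.1 ∈ ⋃ j ∈ J, (Rf j).dom}
      · by_cases hR : R.rel x y
        · obtain ⟨l, hl, -, hp⟩ := hfp.reducedRel hR
          exact Or.inr ⟨l, ⟨hl, fun hJ => h ⟨hx, l, hl, hJ, hp⟩⟩, hp⟩
        · exact Or.inl (Or.inr hR)
      · exact Or.inl (Or.inl hx)
    · rintro ((h | h) | ⟨l, ⟨hl, hJ⟩, hp⟩) ⟨hx, m, hm, hmJ, hp'⟩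
      · exact h hx
      · obtain ⟨j, -, hj⟩ := Set.mem_iUnion₂.1 hx
        exact h (hfp.rel_of_pathRel (hfp.dom_subset j hj) hp')
      · rw [hfp.1.labels_unique hl hm hp hp'] at hJ
        exact hJ hmJ
  rel_dom := fun h => ⟨h.1, h.2.mem_iUnion_dom h.1⟩
  refl := fun x hx => ⟨hx, ReducedRel.refl J x⟩
  symm := fun h => ⟨h.2.mem_iUnion_dom h.1, h.2.symm⟩
  trans := fun h h' => ⟨h.1, h.2.trans h'.2⟩
  countable_classes := fun x => (R.countable_classes x).mono fun y hy => by
    obtain ⟨j, -, hj⟩ := Set.mem_iUnion₂.1 hy.1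
    exact hfp.rel_of_reducedRel (hfp.dom_subset j hj) hy.2

/-- Grouping the factors into two families yields a free product decomposition. -/
lemma IsFreeProduct.grouped_complPair {R : CBER X} (hfp : IsFreeProduct R Rf) (J : Set ι) :
    IsFreeProduct R (fun k : Fin 2 => hfp.grouped (complPair J k)) := by
  have hsub : ∀ (k : Fin 2) (x y : X), (hfp.grouped (complPair J k)).rel x y → R.rel x y := by
    intro k x y h
    obtain ⟨j, -, hj⟩ := Set.mem_iUnion₂.1 h.1
    exact hfp.rel_of_reducedRel (hfp.dom_subset j hj) h.2
  refine ⟨?_, ?_, fun x y => ⟨fun h => ?_, fun h => ?_⟩⟩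
  · intro n x i hn hx hne hrel
    by_contra! hcon
    have key : ∀ k, k + 1 ≤ n → ∃ l : List ι, l ≠ [] ∧ l.IsChain (· ≠ ·) ∧
        (∀ a ∈ l.getLast?, a ∈ complPair J (i k)) ∧ PathRel Rf l (x 0) (x (k + 1)) := by
      intro k
      induction k with
      | zero =>
        intro hk
        obtain ⟨-, l, hl, hJ, hp⟩ := hrel 0 hk
        refine ⟨l, ?_, hl, fun a ha => hJ a (List.mem_of_mem_getLast? ha), hp⟩
        rintro rfl
        exact hne 0 hk hp
      | succ k ih =>
        intro hk
        obtain ⟨m, hm0, hm, hmJ, hmp⟩ := ih (by omega)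
        obtain ⟨-, l, hl, hJ, hp⟩ := hrel (k + 1) hk
        have hl0 : l ≠ [] := by
          rintro rfl
          exact hne (k + 1) hk hp
        refine ⟨m ++ l, by simp [hm0], hm.append hl ?_, ?_, hmp.append hp⟩
        · intro a ha b hb
          exact complPair_disjoint J (hcon k (by omega)) (hmJ a ha)
            (hJ b (List.mem_of_mem_head? hb))
        · intro a ha
          rw [List.getLast?_append_of_ne_nil _ hl0] at ha
          exact hJ a (List.mem_of_mem_getLast? ha)
    obtain ⟨l, hl0, hl, -, hp⟩ := key (n - 1) (by omega)
    rw [show n - 1 + 1 = n by omega, hx] at hp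
    exact hfp.1.not_pathRel_self hl0 hl _ hp
  · rw [hfp.2.1]
    ext x
    simp only [Set.mem_iUnion, IsFreeProduct.grouped]
    constructor
    · rintro ⟨i, hi⟩
      obtain ⟨k, hk⟩ := exists_mem_complPair J i
      exact ⟨k, i, hk, hi⟩
    · rintro ⟨k, i, -, hi⟩
      exact ⟨i, hi⟩
  · obtain ⟨hx, h⟩ := (hfp.2.2 x y).1 h
    refine ⟨hx, h.mono ?_⟩
    rintro a b ⟨i, hi⟩
    obtain ⟨k, hk⟩ := exists_mem_complPair J i
    exact ⟨k, Set.mem_biUnion hk ((Rf i).rel_dom hi).1, ReducedRel.of_rel hk hi⟩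
  · obtain ⟨hx, h⟩ := h
    have hor : x = y ∨ R.rel x y := by
      clear hx
      induction h with
      | rel x y h => exact Or.inr (hsub _ _ _ h.choose_spec)
      | refl x => exact Or.inl rfl
      | symm x y _ ih => exact ih.imp Eq.symm R.symm
      | trans x y z _ _ ih ih' =>
        rcases ih with rfl | ih
        · exact ih'
        rcases ih' with rfl | ih'
        · exact Or.inr ih
        · exact Or.inr (R.trans ih ih')
    rcases hor with rfl | h
    exacts [R.refl x hx, h]

end Grouping

section Flat

variable {X : Type} [MeasurableSpace X] {ι : Type} {Rf : ι → CBER X} {R : CBER X}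

/-- `V` is `J`-flat: its intersection with each `R`-class is empty or a single class of the
relation generated by the factors with index in `J`. -/
structure IsFlat (R : CBER X) (Rf : ι → CBER X) (J : Set ι) (V : Set X) : Prop where
  subset_dom : V ⊆ R.dom
  reducedRel : ∀ y ∈ V, ∀ z ∈ V, R.rel y z → ReducedRel Rf J y z
  mem_of_reducedRel : ∀ y ∈ V, ∀ z, ReducedRel Rf J y z → z ∈ V

/-- The saturation, under the factors with index in `J`, of a set on which `R` is contained in
the relation they generate, is `J`-flat. -/
lemma IsFreeProduct.isFlat_saturation (hfp : IsFreeProduct R Rf) {J : Set ι} {W : Set X}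
    (hdom : W ⊆ R.dom) (hW : ∀ y ∈ W, ∀ z ∈ W, R.rel y z → ReducedRel Rf J y z) :
    IsFlat R Rf J {x | ∃ y ∈ W, ReducedRel Rf J x y} where
  subset_dom := by
    rintro x ⟨y, hy, h⟩
    exact (R.rel_dom (hfp.rel_of_reducedRel (hdom hy) h.symm)).2
  reducedRel := by
    rintro x ⟨y, hy, h⟩ x' ⟨y', hy', h'⟩ hxx'
    have hyx := hfp.rel_of_reducedRel (hdom hy) h.symm
    have hyx' := hfp.rel_of_reducedRel (hdom hy') h'.symm
    exact (h.trans (hW y hy y' hy' (R.trans (R.trans hyx hxx') (R.symm hyx')))).trans h'.symm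
  mem_of_reducedRel := by
    rintro x ⟨y, hy, h⟩ z hxz
    exact ⟨y, hy, hxz.symm.trans h⟩

/-- A reduced path starting in a flat set leaves it at some point along a final segment. -/
lemma IsFlat.exists_exit {J : Set ι} {V : Set X} (hV : IsFlat R Rf J V) {l : List ι} {y x : X}
    (hy : y ∈ V) (hl : l.IsChain (· ≠ ·)) (h : PathRel Rf l y x) :
    ∃ v ∈ V, ∃ m : List ι, m <:+ l ∧ (∀ a ∈ m.head?, a ∉ J) ∧ PathRel Rf m v x := by
  classical
  rw [← List.takeWhile_append_dropWhile (p := fun i => decide (i ∈ J)) (l := l)] at h hl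
  obtain ⟨v, h1, h2⟩ := pathRel_append.1 h
  refine ⟨v, hV.mem_of_reducedRel y hy v ⟨_, hl.left_of_append, ?_, h1⟩, _,
    List.dropWhile_suffix _, ?_, h2⟩
  · intro i hi
    simpa using List.mem_takeWhile_imp hi
  · intro a ha
    have := List.head?_dropWhile_not (fun i => decide (i ∈ J)) l
    rw [ha] at this
    simpa using this

lemma IsFlat.exit_unique (hfp : IsFreeProduct R Rf) {J : Set ι} {V : Set X}
    (hV : IsFlat R Rf J V) {l l' : List ι} {v v' x : X} (hv : v ∈ V) (hv' : v' ∈ V)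
    (hl : l.IsChain (· ≠ ·)) (hl' : l'.IsChain (· ≠ ·)) (hlJ : ∀ a ∈ l.head?, a ∉ J)
    (hlJ' : ∀ a ∈ l'.head?, a ∉ J) (h : PathRel Rf l v x) (h' : PathRel Rf l' v' x) :
    v = v' ∧ l = l' := by
  have hvv' : R.rel v v' := R.trans (hfp.rel_of_pathRel (hV.subset_dom hv) h)
    (R.symm (hfp.rel_of_pathRel (hV.subset_dom hv') h'))
  obtain ⟨m, hm, hmJ, hmp⟩ := hV.reducedRel v hv v' hv' hvv'
  have hc : (m ++ l').IsChain (· ≠ ·) := by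
    refine hm.append hl' fun a ha b hb hab => hlJ' b hb ?_
    exact hab ▸ hmJ a (List.mem_of_mem_getLast? ha)
  obtain rfl := hfp.1.labels_unique hl hc h (hmp.append h')
  cases m with
  | nil => exact ⟨hmp, rfl⟩
  | cons i m => exact absurd (hmJ i (by simp)) (hlJ i (by simp))

variable [Countable ι] [TopologicalSpace X] [PolishSpace X] [BorelSpace X]

/-- Almost every class meeting two flat sets meets their intersection. -/
lemma IsFlat.ae_exists_mem_inter (hfp : IsFreeProduct R Rf) {μ : Measure X} [IsFiniteMeasure μ]
    (hpmp : R.IsPMP μ) (hap : R.Aperiodic) {J K : Set ι} {V W : Set X}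
    (hV : IsFlat R Rf J V) (hW : IsFlat R Rf K W) (hVa : AnalyticSet V) (hWa : AnalyticSet W) :
    ∀ᵐ x ∂μ, (∃ v ∈ V, R.rel x v) → (∃ w ∈ W, R.rel x w) → ∃ u ∈ V ∩ W, R.rel x u := by
  let F : Set X := {v | v ∈ V ∧ (∃ w ∈ W, ∃ l : List ι,
    (l.IsChain (· ≠ ·) ∧ ∀ a ∈ l.head?, a ∉ J) ∧ PathRel Rf l v w)} \
      {v | ∃ u ∈ V ∩ W, R.rel v u}
  have hexit : AnalyticSet {v | ∃ w ∈ W, ∃ l : List ι,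
      (l.IsChain (· ≠ ·) ∧ ∀ a ∈ l.head?, a ∉ J) ∧ PathRel Rf l v w} :=
    AnalyticSet.exists_mem (r := fun v w => ∃ l : List ι,
      (l.IsChain (· ≠ ·) ∧ ∀ a ∈ l.head?, a ∉ J) ∧ PathRel Rf l v w)
      (analyticSet_exists_pathRel Rf _) hWa
  have hmeet : AnalyticSet {v | ∃ u ∈ V ∩ W, R.rel v u} :=
    R.rel_meas.analyticSet.exists_mem (hVa.inter hWa)
  have hF : NullMeasurableSet F μ :=
    NullMeasurableSet.diff ((hVa.inter hexit).nullMeasurableSet μ) (hmeet.nullMeasurableSet μ)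
  have hFdom : F ⊆ R.dom := fun v hv => hV.subset_dom hv.1.1
  have hF0 : μ F = 0 := by
    refine hpmp.measure_transversal_eq_zero hap hF hFdom ?_
    rintro v ⟨⟨hv, w, hw, l, ⟨hl, hlJ⟩, h⟩, hmiss⟩ v' ⟨⟨hv', w', hw', l', ⟨hl', hlJ'⟩, h'⟩, -⟩ hvv'
    obtain ⟨m, hm, hmJ, hmp⟩ := hV.reducedRel v hv v' hv' hvv'
    cases m with
    | nil => exact hmp
    | cons i m =>
      exfalso
      have hc : (l.reverse ++ (i :: m ++ l')).IsChain (· ≠ ·) := by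
        refine hl.reverse_append_of_head?_ne (hm.append hl' ?_) ?_
        · rintro a ha b hb rfl
          exact hlJ' a hb (hmJ a (List.mem_of_mem_getLast? ha))
        · rintro a ha b hb rfl
          refine hlJ a ha (hmJ a ?_)
          simp at hb
          simp [hb]
      have hww' : R.rel w w' :=
        R.trans (R.symm (hfp.rel_of_pathRel (hV.subset_dom hv) h))
          (R.trans hvv' (hfp.rel_of_pathRel (hV.subset_dom hv') h'))
      obtain ⟨k, hk, hkK, hkp⟩ := hW.reducedRel w hw w' hw' hww'
      obtain rfl := hfp.1.labels_unique hk hc hkp (h.reverse.append (hmp.append h'))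
      have hvW : v ∈ W := hW.mem_of_reducedRel w hw v
        ⟨l.reverse, hc.left_of_append, fun i hi => hkK i (List.mem_append_left _ hi), h.reverse⟩
      exact hmiss ⟨v, ⟨hv, hvW⟩, R.refl v (hV.subset_dom hv)⟩
  filter_upwards [hpmp.ae_forall_rel (measure_eq_zero_iff_ae_notMem.1 hF0)] with x hx
  rintro ⟨v₀, hv₀, hxv₀⟩ ⟨w, hw, hxw⟩
  by_contra hmiss
  obtain ⟨l, hl, -, h⟩ := hfp.reducedRel (R.trans (R.symm hxv₀) hxw)
  obtain ⟨v, hv, m, hml, hmJ, hmp⟩ := hV.exists_exit hv₀ hl h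
  have hxv : R.rel x v := R.trans hxw (R.symm (hfp.rel_of_pathRel (hV.subset_dom hv) hmp))
  refine hx v hxv ⟨⟨hv, w, hw, m, ⟨hl.suffix hml, hmJ⟩, hmp⟩, ?_⟩
  rintro ⟨u, hu, hvu⟩
  exact hmiss ⟨u, hu, R.trans hxv hvu⟩

end Flat

section Diagonal

variable {X : Type} [MeasurableSpace X] {ι : Type} {Rf : ι → CBER X} {R : CBER X}

/-- The points from which every member of the sequence `V` can be reached by a reduced path with
labels in `J`. -/
def reachSet (Rf : ι → CBER X) (V : ℕ → Set X) (J : Set ι) : Set X :=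
  {x | ∀ n, ∃ y ∈ V n, ReducedRel Rf J x y}

lemma reachSet_mono (Rf : ι → CBER X) (V : ℕ → Set X) {J K : Set ι} (hJK : J ⊆ K) :
    reachSet Rf V J ⊆ reachSet Rf V K := by
  intro x hx n
  obtain ⟨y, hy, h⟩ := hx n
  exact ⟨y, hy, h.mono hJK⟩

/-- The classes meeting every member of the sequence `V`, but not its intersection. -/
def vanishSet (R : CBER X) (V : ℕ → Set X) : Set X :=
  {x | (∀ n, ∃ y ∈ V n, R.rel x y) ∧ ¬ ∃ y ∈ ⋂ n, V n, R.rel x y}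

lemma vanishSet_of_rel {V : ℕ → Set X} {x y : X} (hx : x ∈ vanishSet R V) (h : R.rel x y) :
    y ∈ vanishSet R V := by
  refine ⟨fun n => ?_, ?_⟩
  · obtain ⟨z, hz, hxz⟩ := hx.1 n
    exact ⟨z, hz, R.trans (R.symm h) hxz⟩
  · rintro ⟨z, hz, hyz⟩
    exact hx.2 ⟨z, hz, R.trans h hyz⟩

lemma iInter_reachSet_inter_vanishSet (hfp : IsFreeProduct R Rf) {e : ι → ℕ} {V : ℕ → Set X}
    (hV : ∀ n, IsFlat R Rf {i | n < e i} (V n)) (hanti : Antitone V) (m : ℕ) :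
    (⋂ n, reachSet Rf V {i | e i ≤ m ∨ n < e i} ∩ vanishSet R V) = ∅ := by
  rw [Set.eq_empty_iff_forall_notMem]
  intro x hx
  rw [Set.mem_iInter] at hx
  have hexit : ∀ k n, ∃ v ∈ V k, ∃ l : List ι, l.IsChain (· ≠ ·) ∧
      (∀ i ∈ l, e i ≤ m ∨ n < e i) ∧ (∀ a ∈ l.head?, a ∉ {i | k < e i}) ∧ PathRel Rf l v x := by
    intro k n
    obtain ⟨y, hy, hxy⟩ := (hx n).1 k
    obtain ⟨l, hl, hlJ, hp⟩ := hxy.symm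
    obtain ⟨v, hv, l', hl', hlk, hp'⟩ := (hV k).exists_exit hy hl hp
    exact ⟨v, hv, l', hl.suffix hl', fun i hi => hlJ i (hl'.subset hi), hlk, hp'⟩
  have hreach : ∀ k, ∃ v ∈ V k, ReducedRel Rf {i | e i ≤ m} x v := by
    intro k
    obtain ⟨v, hv, l, hl, -, hlk, hp⟩ := hexit k 0
    refine ⟨v, hv, ReducedRel.symm ⟨l, hl, fun i hi => ?_, hp⟩⟩
    obtain ⟨v', hv', l', hl', hJ', hlk', hp'⟩ := hexit k (e i)
    obtain ⟨-, rfl⟩ := (hV k).exit_unique hfp hv hv' hl hl' hlk hlk' hp hp'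
    exact (hJ' i hi).resolve_right (lt_irrefl _)
  choose v hv hxv using hreach
  have hxdom : x ∈ R.dom := by
    obtain ⟨y, -, h⟩ := (hx 0).2.1 0
    exact (R.rel_dom h).1
  refine (hx 0).2.2 ⟨v m, Set.mem_iInter.2 fun k => ?_, hfp.rel_of_reducedRel hxdom (hxv m)⟩
  rcases le_total k m with hkm | hmk
  · exact hanti hkm (hv m)
  have h1 : ReducedRel Rf {i | e i ≤ m} (v m) (v k) := (hxv m).symm.trans (hxv k)
  have h2 : ReducedRel Rf {i | m < e i} (v m) (v k) :=
    (hV m).reducedRel _ (hv m) _ (hanti hmk (hv k))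
      (hfp.rel_of_reducedRel ((hV m).subset_dom (hv m)) h1)
  have h3 := (hfp.1.reducedRel_inter h1 h2).mono (K := ∅) fun i hi =>
    absurd hi.2 (not_lt.2 (show e i ≤ m from hi.1))
  rw [h3.eq_of_empty]
  exact hv k

variable [Countable ι] [TopologicalSpace X] [PolishSpace X] [BorelSpace X]

lemma analyticSet_reachSet (Rf : ι → CBER X) {V : ℕ → Set X} (hV : ∀ n, AnalyticSet (V n))
    (J : Set ι) : AnalyticSet (reachSet Rf V J) := by
  have : reachSet Rf V J = ⋂ n, {x | ∃ y ∈ V n, ReducedRel Rf J x y} := by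
    ext x
    simp [reachSet]
  rw [this]
  exact AnalyticSet.iInter fun n => (analyticSet_reducedRel Rf J).exists_mem (hV n)

lemma nullMeasurableSet_vanishSet (R : CBER X) {V : ℕ → Set X} (hV : ∀ n, AnalyticSet (V n))
    (μ : Measure X) [IsFiniteMeasure μ] : NullMeasurableSet (vanishSet R V) μ := by
  have hmeet : ∀ W : Set X, AnalyticSet W → AnalyticSet {x | ∃ y ∈ W, R.rel x y} := fun W hW =>
    R.rel_meas.analyticSet.exists_mem hW
  have : vanishSet R V = (⋂ n, {x | ∃ y ∈ V n, R.rel x y}) \ {x | ∃ y ∈ ⋂ n, V n, R.rel x y} := by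
    ext x
    simp [vanishSet]
  rw [this]
  exact NullMeasurableSet.diff
    ((AnalyticSet.iInter fun n => hmeet _ (hV n)).nullMeasurableSet μ)
    ((hmeet _ (AnalyticSet.iInter hV)).nullMeasurableSet μ)

/-- There is a set `J` of indices such that almost no vanishing class can reach all the `V n`
using only labels in `J`, or only labels outside `J`. -/
lemma exists_compl_reachSet_null (hfp : IsFreeProduct R Rf) {e : ι → ℕ} {V : ℕ → Set X}
    (hV : ∀ n, IsFlat R Rf {i | n < e i} (V n)) (hanti : Antitone V)
    (hVa : ∀ n, AnalyticSet (V n)) (μ : Measure X) [IsFiniteMeasure μ] :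
    ∃ J : Set ι, ∀ k, μ (reachSet Rf V (complPair J k) ∩ vanishSet R V) = 0 := by
  have hsmall : ∀ m : ℕ, ∃ n, m < n ∧
      μ (reachSet Rf V {i | e i ≤ m ∨ n < e i} ∩ vanishSet R V) < (2 : ENNReal)⁻¹ ^ m := by
    intro m
    have hlim := tendsto_measure_iInter_atTop (μ := μ)
      (s := fun n => reachSet Rf V {i | e i ≤ m ∨ n < e i} ∩ vanishSet R V)
      (fun n => ((analyticSet_reachSet Rf hVa _).nullMeasurableSet μ).inter
        (nullMeasurableSet_vanishSet R hVa μ))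
      (fun a b hab => Set.inter_subset_inter_left _ (reachSet_mono Rf V
        fun i hi => hi.imp_right fun h => lt_of_le_of_lt hab h))
      ⟨0, measure_ne_top _ _⟩
    rw [iInter_reachSet_inter_vanishSet hfp hV hanti m, measure_empty] at hlim
    have hpos : (0 : ENNReal) < (2 : ENNReal)⁻¹ ^ m := ENNReal.pow_pos (by simp) m
    exact ((Filter.eventually_gt_atTop m).and (hlim.eventually (gt_mem_nhds hpos))).exists
  choose g hg hgμ using hsmall
  let a : ℕ → ℕ := fun k => g^[k] 0
  have ha : ∀ k, a (k + 1) = g (a k) := fun k => Function.iterate_succ_apply' g k 0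
  have hmono : StrictMono a := strictMono_nat_of_lt_succ fun k => by
    rw [ha]
    exact hg _
  have hnull : ∀ K : Set ι,
      (∀ n, ∃ k ≥ n, K ⊆ {i | e i ≤ a k ∨ a (k + 1) < e i}) →
      μ (reachSet Rf V K ∩ vanishSet R V) = 0 := by
    intro K hK
    have hle : ∀ n : ℕ, μ (reachSet Rf V K ∩ vanishSet R V) ≤ (2 : ENNReal)⁻¹ ^ n := by
      intro n
      obtain ⟨k, hkn, hk⟩ := hK n
      rw [ha] at hk
      refine (measure_mono (Set.inter_subset_inter_left _ (reachSet_mono Rf V hk))).trans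
        ((hgμ (a k)).le.trans ?_)
      exact pow_le_pow_right_of_le_one' (by simp) (hkn.trans (hmono.id_le k))
    exact nonpos_iff_eq_zero.1
      (ge_of_tendsto' (ENNReal.tendsto_pow_atTop_nhds_zero_of_lt_one (by simp)) hle)
  refine ⟨{i | ∃ k, Even k ∧ a k < e i ∧ e i ≤ a (k + 1)}, fun k => ?_⟩
  by_cases hk : k = 0
  · simp only [complPair, hk, if_true]
    refine hnull _ fun n => ⟨2 * n + 1, by omega, ?_⟩
    rintro i ⟨j, hj, h1, h2⟩
    rcases lt_trichotomy j (2 * n + 1) with h | h | h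
    · exact Or.inl (h2.trans (hmono.monotone h))
    · exact absurd hj (by rw [h]; simp)
    · exact Or.inr (lt_of_le_of_lt (hmono.monotone h) h1)
  · simp only [complPair, hk, if_false]
    refine hnull _ fun n => ⟨2 * n, by omega, ?_⟩
    intro i hi
    by_contra hcon
    simp only [Set.mem_ofPred_eq, not_or, not_le, not_lt] at hcon
    exact hi ⟨2 * n, by simp, hcon.1, hcon.2⟩

/-- A two-piece decomposition that is inessential modulo null sets, read in terms of reduced
paths of a finer decomposition. -/
lemma IsFreeProduct.exists_pieces (hfp : IsFreeProduct R Rf) {μ : Measure X} [IsFiniteMeasure μ]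
    (hpmp : R.IsPMP μ)
    (H : ∀ S : Fin 2 → CBER X, IsFreeProduct R S → InessentialMod μ R S) (J : Set ι) :
    ∃ W : Fin 2 → Set X, (∀ k, MeasurableSet (W k)) ∧ (∀ k, W k ⊆ R.dom) ∧
      (∀ k, ∀ x ∈ W k, ∀ y ∈ W k, R.rel x y →
        x ∈ (⋃ j ∈ complPair J k, (Rf j).dom) ∧ ReducedRel Rf (complPair J k) x y) ∧
      ∀ᵐ x ∂μ, x ∈ R.dom → ∃ k, ∃ y ∈ W k, R.rel x y := by
  obtain ⟨U, C, hU, hUdom, -, hC, hC0, hcov, -, hrel⟩ := H _ (hfp.grouped_complPair J)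
  refine ⟨fun k => U k ∩ C, fun k => (hU k).inter hC, fun k => Set.inter_subset_left.trans
    (hUdom k), fun k x hx y hy h => (hrel k x hx y hy).1 h, ?_⟩
  have hae : ∀ᵐ x ∂μ, x ∈ C := hC0
  filter_upwards [hae, hpmp.ae_forall_rel hae] with x hx hx' hxdom
  obtain ⟨y, hy, hxy⟩ := hcov x ⟨hxdom, hx⟩
  obtain ⟨k, hk⟩ := Set.mem_iUnion.1 hy
  exact ⟨k, y, ⟨hk, hx' y hxy⟩, hxy⟩

/-- If all two-piece decompositions are inessential, almost no class meets every member of a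
decreasing sequence of flat sets obtained by discarding the factors one after the other. -/
lemma measure_vanishSet_eq_zero (hfp : IsFreeProduct R Rf) {μ : Measure X} [IsFiniteMeasure μ]
    (hpmp : R.IsPMP μ) (hap : R.Aperiodic)
    (H : ∀ S : Fin 2 → CBER X, IsFreeProduct R S → InessentialMod μ R S)
    {e : ι → ℕ} {V : ℕ → Set X} (hV : ∀ n, IsFlat R Rf {i | n < e i} (V n))
    (hanti : Antitone V) (hVa : ∀ n, AnalyticSet (V n)) : μ (vanishSet R V) = 0 := by
  obtain ⟨J, hJ⟩ := exists_compl_reachSet_null hfp hV hanti hVa μ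
  obtain ⟨W, hW, hWdom, hWrel, hWcov⟩ := hfp.exists_pieces hpmp H J
  have hflat : ∀ k, IsFlat R Rf (complPair J k)
      {x | ∃ y ∈ W k, ReducedRel Rf (complPair J k) x y} := fun k =>
    hfp.isFlat_saturation (hWdom k) fun y hy z hz h => (hWrel k y hy z hz h).2
  have hmeet : ∀ᵐ x ∂μ, ∀ (k : Fin 2) (n : ℕ), (∃ v ∈ V n, R.rel x v) →
      (∃ w ∈ {x | ∃ y ∈ W k, ReducedRel Rf (complPair J k) x y}, R.rel x w) →
      ∃ u ∈ V n ∩ {x | ∃ y ∈ W k, ReducedRel Rf (complPair J k) x y}, R.rel x u := by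
    rw [ae_all_iff]
    intro k
    rw [ae_all_iff]
    intro n
    exact (hV n).ae_exists_mem_inter hfp hpmp hap (hflat k) (hVa n)
      ((analyticSet_reducedRel Rf _).exists_mem (hW k).analyticSet)
  have hreach : ∀ᵐ x ∂μ, ∀ k : Fin 2, x ∉ reachSet Rf V (complPair J k) ∩ vanishSet R V :=
    ae_all_iff.2 fun k => measure_eq_zero_iff_ae_notMem.1 (hJ k)
  rw [measure_eq_zero_iff_ae_notMem]
  filter_upwards [hWcov, hmeet, hpmp.ae_forall_rel hreach] with x hxW hxm hxr hx
  have hxdom : x ∈ R.dom := by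
    obtain ⟨y, -, h⟩ := hx.1 0
    exact (R.rel_dom h).1
  obtain ⟨k, y, hy, hxy⟩ := hxW hxdom
  choose u hu hxu using fun n => hxm k n (hx.1 n) ⟨y, ⟨y, hy, ReducedRel.refl _ y⟩, hxy⟩
  refine hxr (u 0) (hxu 0) k ⟨fun n => ⟨u n, (hu n).1, ?_⟩, vanishSet_of_rel hx (hxu 0)⟩
  exact (hflat k).reducedRel _ (hu 0).2 _ (hu n).2 (R.trans (R.symm (hxu 0)) (hxu n))

end Diagonal

section Assembly

variable {X : Type} [MeasurableSpace X] {ι : Type} {Rf : ι → CBER X} {R : CBER X}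

lemma IsFreeProduct.isFlat_setOf_forall_le (hfp : IsFreeProduct R Rf) {D : ι → Set X}
    (hD : ∀ i, IsFlat R Rf {i}ᶜ (D i)) (e : ι → ℕ) (n : ℕ) :
    IsFlat R Rf {i | n < e i} {x | x ∈ R.dom ∧ ∀ i, e i ≤ n → x ∈ D i} where
  subset_dom := fun x hx => hx.1
  reducedRel := by
    intro y hy z hz hyz
    obtain ⟨l, hl, -, hp⟩ := hfp.reducedRel hyz
    refine ⟨l, hl, fun i hi => ?_, hp⟩
    by_contra hin
    have hle : e i ≤ n := not_lt.1 hin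
    obtain ⟨m, hm, hmi, hp'⟩ := (hD i).reducedRel y (hy.2 i hle) z (hz.2 i hle) hyz
    obtain rfl := hfp.1.labels_unique hl hm hp hp'
    exact hmi i hi rfl
  mem_of_reducedRel := by
    intro y hy z hyz
    refine ⟨(R.rel_dom (hfp.rel_of_reducedRel hy.1 hyz)).2, fun i hi =>
      (hD i).mem_of_reducedRel y (hy.2 i hi) z (hyz.mono ?_)⟩
    rintro j hj rfl
    exact absurd hi (not_le.2 hj)

lemma IsFreeProduct.iInter_transversal (hfp : IsFreeProduct R Rf) {e : ι → ℕ} {V : ℕ → Set X}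
    (hV : ∀ n, IsFlat R Rf {i | n < e i} (V n)) :
    ∀ x ∈ ⋂ n, V n, ∀ y ∈ ⋂ n, V n, R.rel x y → x = y := by
  intro x hx y hy hxy
  rw [Set.mem_iInter] at hx hy
  obtain ⟨l, hl, -, hp⟩ := hfp.reducedRel hxy
  cases l with
  | nil => exact hp
  | cons i l =>
    obtain ⟨m, hm, hme, hp'⟩ := (hV (e i)).reducedRel x (hx _) y (hy _) hxy
    obtain rfl := hfp.1.labels_unique hl hm hp hp'
    exact absurd (hme i (by simp)) (lt_irrefl (e i))

variable [Countable ι] [TopologicalSpace X] [PolishSpace X] [BorelSpace X]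

/-- If all two-piece decompositions are inessential, then given for each `i` a set flat for the
complement of `i`, almost every class misses one of them. -/
lemma IsFreeProduct.ae_exists_not_meets (hfp : IsFreeProduct R Rf) {μ : Measure X}
    [IsFiniteMeasure μ] (hpmp : R.IsPMP μ) (hap : R.Aperiodic)
    (H : ∀ S : Fin 2 → CBER X, IsFreeProduct R S → InessentialMod μ R S)
    {D : ι → Set X} (hD : ∀ i, IsFlat R Rf {i}ᶜ (D i)) (hDa : ∀ i, AnalyticSet (D i)) :
    ∀ᵐ x ∂μ, x ∈ R.dom → ∃ i, ¬ ∃ y ∈ D i, R.rel x y := by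
  obtain ⟨e₀, he₀⟩ := exists_injective_nat ι
  let e : ι → ℕ := fun i => e₀ i + 1
  have he : Function.Injective e := fun i j h => he₀ (Nat.succ_injective h)
  let V : ℕ → Set X := fun n => {x | x ∈ R.dom ∧ ∀ i, e i ≤ n → x ∈ D i}
  have hV : ∀ n, IsFlat R Rf {i | n < e i} (V n) := hfp.isFlat_setOf_forall_le hD e
  have hanti : Antitone V := fun m n hmn x hx => ⟨hx.1, fun i hi => hx.2 i (hi.trans hmn)⟩
  have hVa : ∀ n, AnalyticSet (V n) := by
    intro n
    have hVn : V n = R.dom ∩ ⋂ i : {i // e i ≤ n}, D i := by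
      ext x
      simp [V]
    rw [hVn]
    rcases isEmpty_or_nonempty {i // e i ≤ n} with hem | hne
    · simpa using R.dom_meas.analyticSet
    · exact R.dom_meas.analyticSet.inter (AnalyticSet.iInter fun i => hDa i)
  have hmeet : ∀ n, ∀ᵐ x ∂μ, x ∈ R.dom → (∀ i, ∃ y ∈ D i, R.rel x y) →
      ∃ y ∈ V n, R.rel x y := by
    intro n
    induction n with
    | zero =>
      refine ae_of_all _ fun x hx _ => ⟨x, ⟨hx, fun i hi => ?_⟩, R.refl x hx⟩
      exact absurd hi (Nat.not_succ_le_zero _)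
    | succ n ih =>
      by_cases hex : ∃ i, e i = n + 1
      · obtain ⟨i, hi⟩ := hex
        filter_upwards [ih, (hV n).ae_exists_mem_inter hfp hpmp hap (hD i) (hVa n) (hDa i)]
          with x hx hx' hxdom hxD
        obtain ⟨u, hu, hxu⟩ := hx' (hx hxdom hxD) (hxD i)
        refine ⟨u, ⟨hu.1.1, fun j hj => ?_⟩, hxu⟩
        rcases Nat.le_succ_iff.1 hj with hj | hj
        · exact hu.1.2 j hj
        · rw [he (hj.trans hi.symm)]
          exact hu.2
      · filter_upwards [ih] with x hx hxdom hxD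
        obtain ⟨u, hu, hxu⟩ := hx hxdom hxD
        refine ⟨u, ⟨hu.1, fun j hj => ?_⟩, hxu⟩
        rcases Nat.le_succ_iff.1 hj with hj | hj
        · exact hu.2 j hj
        · exact absurd ⟨j, hj⟩ hex
  have htrans : μ (⋂ n, V n) = 0 := hpmp.measure_transversal_eq_zero hap
    ((AnalyticSet.iInter hVa).nullMeasurableSet μ)
    ((Set.iInter_subset V 0).trans (hV 0).subset_dom) (hfp.iInter_transversal hV)
  have hvanish := measure_vanishSet_eq_zero hfp hpmp hap H hV hanti hVa
  filter_upwards [ae_all_iff.2 hmeet, measure_eq_zero_iff_ae_notMem.1 hvanish,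
    hpmp.ae_forall_rel (measure_eq_zero_iff_ae_notMem.1 htrans)] with x hxm hxv hxt hxdom
  by_contra! hcon
  refine hxv ⟨fun n => hxm n hxdom hcon, ?_⟩
  rintro ⟨y, hy, hxy⟩
  exact hxt y hxy hy

/-- A countable family of sets, jointly meeting almost every class and on each of which `R`
coincides with the corresponding factor, can be cut down to a trivialization. -/
lemma inessentialMod_of_ae_meets {μ : Measure X} [IsFiniteMeasure μ] (hpmp : R.IsPMP μ)
    {A : ι → Set X} (hA : ∀ i, MeasurableSet (A i)) (hAdom : ∀ i, A i ⊆ R.dom)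
    (hrel : ∀ i, ∀ x ∈ A i, ∀ y ∈ A i, (R.rel x y ↔ (Rf i).rel x y))
    (hcov : ∀ᵐ x ∂μ, x ∈ R.dom → ∃ i, ∃ y ∈ A i, R.rel x y) : InessentialMod μ R Rf := by
  obtain ⟨e, he⟩ := exists_injective_nat ι
  have hsat : ∀ i, NullMeasurableSet {x | ∃ y ∈ A i, R.rel x y} μ := fun i =>
    (R.rel_meas.analyticSet.exists_mem (hA i).analyticSet).nullMeasurableSet μ
  choose Z hZ hZae using hsat
  have hZae' : ∀ᵐ x ∂μ, ∀ i, (∃ y ∈ A i, R.rel x y) ↔ x ∈ Z i :=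
    ae_all_iff.2 fun i => (hZae i).mem_iff
  obtain ⟨N, hNsub, hN, hN0⟩ := exists_measurable_superset_of_null
    (hcov.and (hpmp.ae_forall_rel hZae'))
  have hC : ∀ x, x ∉ N → (x ∈ R.dom → ∃ i, ∃ y ∈ A i, R.rel x y) ∧
      ∀ y, R.rel x y → ∀ i, (∃ z ∈ A i, R.rel y z) ↔ y ∈ Z i := fun x hx => by
    by_contra h
    exact hx (hNsub h)
  refine ⟨fun i => A i \ ⋃ j ∈ {j | e j < e i}, (Z j ∪ A j), Nᶜ, fun i => ?_, fun i =>
    Set.sdiff_subset.trans (hAdom i), ?_, hN.compl, by rwa [compl_compl], ?_, ?_, ?_⟩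
  · exact (hA i).diff (MeasurableSet.biUnion (Set.to_countable _) fun j _ => (hZ j).union (hA j))
  · have hlt : ∀ i j x, e i < e j → x ∈ A i →
        x ∉ A j \ ⋃ k ∈ {k | e k < e j}, (Z k ∪ A k) := fun i j x hij hx hx' =>
      hx'.2 (Set.mem_biUnion (show i ∈ {k | e k < e j} from hij) (Or.inr hx))
    intro i j hij
    refine Set.disjoint_left.2 fun x hx hx' => ?_
    rcases lt_or_gt_of_ne (he.ne hij) with h | h
    exacts [hlt i j x h hx.1 hx', hlt j i x h hx'.1 hx]
  · rintro x ⟨hxdom, hxN⟩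
    have hex : ∃ n i, e i = n ∧ ∃ y ∈ A i, R.rel x y := by
      obtain ⟨i, hi⟩ := (hC x hxN).1 hxdom
      exact ⟨e i, i, rfl, hi⟩
    classical
    obtain ⟨i, hi, y, hy, hxy⟩ := Nat.find_spec hex
    have hmin : ∀ j, e j < e i → ¬ ∃ z ∈ A j, R.rel x z := fun j hj h =>
      Nat.find_min hex (hi ▸ hj) ⟨j, rfl, h⟩
    refine ⟨y, Set.mem_iUnion.2 ⟨i, hy, fun hmem => ?_⟩, hxy⟩
    obtain ⟨j, hj, hyj | hyj⟩ := Set.mem_iUnion₂.1 hmem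
    · obtain ⟨z, hz, hyz⟩ := ((hC x hxN).2 y hxy j).2 hyj
      exact hmin j hj ⟨z, hz, R.trans hxy hyz⟩
    · exact hmin j hj ⟨y, hyj, hxy⟩
  · have hlt : ∀ i j x y, x ∉ N → x ∈ A i → y ∈ A j \ ⋃ k ∈ {k | e k < e j}, (Z k ∪ A k) →
        R.rel x y → ¬ e i < e j := fun i j x y hxN hx hy hxy hij =>
      hy.2 (Set.mem_biUnion (show i ∈ {k | e k < e j} from hij)
        (Or.inl (((hC x hxN).2 y hxy i).1 ⟨x, hx, R.symm hxy⟩)))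
    rintro i j x ⟨hx, hxN⟩ y ⟨hy, hyN⟩ hxy
    exact he (le_antisymm (not_lt.1 (hlt j i y x hyN hy.1 hx (R.symm hxy)))
      (not_lt.1 (hlt i j x y hxN hx.1 hy hxy)))
  · rintro i x ⟨hx, -⟩ y ⟨hy, -⟩
    exact hrel i x hx.1 y hy.1

end Assembly

/-- For aperiodic p.m.p. relations, free indecomposability can be checked on
free product decompositions into two pieces. -/
theorem FI_iff_two_piece_decompositions_inessential
    {X : Type} [MeasurableSpace X] [StandardBorelSpace X]
    (μ : MeasureTheory.Measure X) [MeasureTheory.IsProbabilityMeasure μ]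
    (R : CBER X) (hpmp : R.IsPMP μ) (hap : R.Aperiodic) :
    FreelyIndecomposableMod μ R ↔
      ∀ S : Fin 2 → CBER X, IsFreeProduct R S → InessentialMod μ R S := by
  refine ⟨fun h S hS => h (Fin 2) inferInstance S hS, fun H ι _ Rf hfp => ?_⟩
  let := upgradeStandardBorel X
  choose W hW hWdom hWrel hWcov using fun i : ι => hfp.exists_pieces hpmp H {i}
  have hflat : ∀ i, IsFlat R Rf {i}ᶜ {x | ∃ y ∈ W i 1, ReducedRel Rf {i}ᶜ x y} := fun i =>
    hfp.isFlat_saturation (hWdom i 1) fun y hy z hz h => (hWrel i 1 y hy z hz h).2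
  refine inessentialMod_of_ae_meets hpmp (A := fun i => W i 0) (fun i => hW i 0)
    (fun i => hWdom i 0) (fun i x hx y hy => ⟨fun h => ?_, hfp.rel_of_factor⟩) ?_
  · obtain ⟨hxdom, hred⟩ := hWrel i 0 x hx y hy h
    refine ReducedRel.rel_of_singleton hred ?_
    obtain ⟨j, rfl, hj⟩ := Set.mem_iUnion₂.1 hxdom
    exact hj
  · filter_upwards [ae_all_iff.2 hWcov, hfp.ae_exists_not_meets hpmp hap H hflat fun i =>
      (analyticSet_reducedRel Rf _).exists_mem (hW i 1).analyticSet] with x hx hx' hxdom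
    obtain ⟨i, hi⟩ := hx' hxdom
    obtain ⟨k, y, hy, hxy⟩ := hx i hxdom
    refine ⟨i, y, ?_, hxy⟩
    by_cases hk : k = 0
    · rwa [hk] at hy
    · obtain rfl : k = 1 := Fin.eq_one_of_ne_zero k hk
      exact absurd ⟨y, ⟨y, hy, ReducedRel.refl _ y⟩, hxy⟩ hi
end

section
/- If a p.m.p. countable Borel equivalence relation R on a standard probability space (X, μ) is freely indecomposable, then for every Borel set Y ⊆ X with μ(Y) > 0 the restriction R|Y is also freely indecomposable. -/
open MeasureTheory

section LusinNovikov

variable {X Y Z β : Type}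

/-- A Borel graph: a Borel subset of a product whose vertical sections have at most one point. -/
def IsBorelGraph [MeasurableSpace X] [MeasurableSpace Y] (Γ : Set (X × Y)) : Prop :=
  MeasurableSet Γ ∧ ∀ x y y', (x, y) ∈ Γ → (x, y') ∈ Γ → y = y'

/-- A countable union of Borel graphs. -/
def IsSigmaGraph [MeasurableSpace X] [MeasurableSpace Y] (G : Set (X × Y)) : Prop :=
  ∃ C : Set (Set (X × Y)), C.Countable ∧ (∀ Γ ∈ C, IsBorelGraph Γ) ∧ G = ⋃₀ C

theorem IsBorelGraph.isSigmaGraph [MeasurableSpace X] [MeasurableSpace Y] {Γ : Set (X × Y)}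
    (h : IsBorelGraph Γ) : IsSigmaGraph Γ :=
  ⟨{Γ}, Set.countable_singleton _, by simpa using h, by simp⟩

theorem isSigmaGraph_empty [MeasurableSpace X] [MeasurableSpace Y] :
    IsSigmaGraph (∅ : Set (X × Y)) :=
  ⟨∅, Set.countable_empty, by simp, by simp⟩

theorem IsSigmaGraph.iUnion [MeasurableSpace X] [MeasurableSpace Y] {κ : Type*} [Countable κ]
    {G : κ → Set (X × Y)} (h : ∀ k, IsSigmaGraph (G k)) : IsSigmaGraph (⋃ k, G k) := by
  choose C hC hg hG using h
  refine ⟨⋃ k, C k, Set.countable_iUnion hC, ?_, ?_⟩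
  · intro Γ hΓ
    obtain ⟨k, hk⟩ := Set.mem_iUnion.1 hΓ
    exact hg k Γ hk
  · rw [Set.sUnion_iUnion]
    exact Set.iUnion_congr hG

theorem IsSigmaGraph.union [MeasurableSpace X] [MeasurableSpace Y] {G H : Set (X × Y)}
    (hG : IsSigmaGraph G) (hH : IsSigmaGraph H) : IsSigmaGraph (G ∪ H) := by
  rw [Set.union_eq_iUnion]
  exact IsSigmaGraph.iUnion (fun b => by cases b <;> assumption)

theorem IsSigmaGraph.measurableSet [MeasurableSpace X] [MeasurableSpace Y] {G : Set (X × Y)}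
    (hG : IsSigmaGraph G) : MeasurableSet G := by
  obtain ⟨C, hC, hg, rfl⟩ := hG
  exact MeasurableSet.sUnion hC fun Γ hΓ => (hg Γ hΓ).1

/-- An analytic set with vertical sections of at most one point is contained in a Borel graph. -/
theorem exists_borelGraph_of_functional {W : Type*} [MeasurableSpace W] [StandardBorelSpace W]
    [MeasurableSpace X] [TopologicalSpace X] [PolishSpace X] [BorelSpace X]
    [MeasurableSpace Y] [TopologicalSpace Y] [PolishSpace Y] [BorelSpace Y]
    {T : Set W} (hT : MeasurableSet T) {p : W → X} {q : W → Y} (hp : Measurable p)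
    (hq : Measurable q) (hf : ∀ w ∈ T, ∀ w' ∈ T, p w = p w' → q w = q w') :
    ∃ Γ : Set (X × Y), IsBorelGraph Γ ∧ ∀ w ∈ T, (p w, q w) ∈ Γ := by
  have hsep : ∀ V : TopologicalSpace.countableBasis Y, ∃ E : Set X, MeasurableSet E ∧
      ∀ w ∈ T, (q w ∈ (V : Set Y) ↔ p w ∈ E) := by
    intro V
    have hV : MeasurableSet (V : Set Y) :=
      (TopologicalSpace.isOpen_of_mem_countableBasis V.2).measurableSet
    have h1 : MeasureTheory.AnalyticSet (p '' (T ∩ q ⁻¹' V)) :=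
      (hT.inter (hq hV)).analyticSet_image hp
    have h2 : MeasureTheory.AnalyticSet (p '' (T ∩ (q ⁻¹' V)ᶜ)) :=
      (hT.inter (hq hV).compl).analyticSet_image hp
    have hd : Disjoint (p '' (T ∩ q ⁻¹' V)) (p '' (T ∩ (q ⁻¹' V)ᶜ)) := by
      rw [Set.disjoint_left]
      rintro _ ⟨w, ⟨hw, hwV⟩, rfl⟩ ⟨w', ⟨hw', hwV'⟩, h⟩
      apply hwV'
      have := hf w' hw' w hw h
      change q w' ∈ (V : Set Y)
      rw [this]
      exact hwV
    obtain ⟨E, hE1, hE2, hE⟩ := h1.measurablySeparable h2 hd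
    refine ⟨E, hE, fun w hw => ⟨fun h => hE1 ⟨w, ⟨hw, h⟩, rfl⟩, fun h => ?_⟩⟩
    by_contra hn
    exact Set.disjoint_left.1 hE2 ⟨w, ⟨hw, hn⟩, rfl⟩ h
  choose E hE hTE using hsep
  refine ⟨⋂ V : TopologicalSpace.countableBasis Y,
    {z : X × Y | z.2 ∈ (V : Set Y) ↔ z.1 ∈ E V}, ⟨?_, ?_⟩, ?_⟩
  · have := (TopologicalSpace.countable_countableBasis Y).to_subtype
    refine MeasurableSet.iInter fun V => ?_
    have hV : MeasurableSet (V : Set Y) :=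
      (TopologicalSpace.isOpen_of_mem_countableBasis V.2).measurableSet
    exact MeasurableSet.iff (measurable_snd hV) (measurable_fst (hE V))
  · intro x y y' h h'
    by_contra hne
    obtain ⟨O, O', hO, -, hy, hy', hd⟩ := t2_separation hne
    obtain ⟨V, hV, hyV, hVO⟩ :=
      (TopologicalSpace.isBasis_countableBasis Y).exists_subset_of_mem_open hy hO
    have h1 := (Set.mem_iInter.1 h ⟨V, hV⟩).1 hyV
    have h2 := (Set.mem_iInter.1 h' ⟨V, hV⟩).2 h1
    exact Set.disjoint_left.1 hd (hVO h2) hy'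
  · intro w hw
    exact Set.mem_iInter.2 fun V => hTE V w hw

/-- A family of sets of parameters is large if no countable union of Borel graphs exhausts,
above every point, the vertical section described by some member of the family. -/
def Large [MeasurableSpace X] [MeasurableSpace Y] (p : Z → X) (q : Z → Y) (s : β → Set Z) :
    Prop :=
  ∀ G : Set (X × Y), IsSigmaGraph G → ∃ x, ∀ b, ∃ z ∈ s b, p z = x ∧ (p z, q z) ∉ G

theorem Large.refine [MeasurableSpace X] [MeasurableSpace Y] [DecidableEq β] {p : Z → X}
    {q : Z → Y} {s : β → Set Z} (hs : Large p q s) (b : β) {κ : Type*} [Countable κ]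
    (t : κ → Set Z) (hst : s b ⊆ ⋃ k, t k) :
    ∃ k, Large p q (Function.update s b (t k)) := by
  by_contra! hn
  simp only [Large, not_forall] at hn
  choose G hG hx using hn
  obtain ⟨x, hx'⟩ := hs _ (IsSigmaGraph.iUnion hG)
  choose z hz hzx hzG using hx'
  obtain ⟨k, hk⟩ := Set.mem_iUnion.1 (hst (hz b))
  refine hx k ⟨x, fun c => ⟨z c, ?_, hzx c, fun h => hzG c (Set.mem_iUnion.2 ⟨k, h⟩)⟩⟩
  rcases eq_or_ne c b with rfl | hc
  · simpa using hk
  · simpa [Function.update_of_ne hc] using hz c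

variable [TopologicalSpace X] [PolishSpace X] [MeasurableSpace X] [BorelSpace X]
  [TopologicalSpace Y] [PolishSpace Y] [MeasurableSpace Y] [BorelSpace Y]

theorem Large.split [TopologicalSpace Z] [PolishSpace Z] [MeasurableSpace Z] [BorelSpace Z]
    [Countable β] [DecidableEq β] {p : Z → X} {q : Z → Y} (hp : Measurable p) (hq : Measurable q)
    {s : β → Set Z} (hs : Large p q s) (hm : ∀ b, MeasurableSet (s b)) {b c : β} (hbc : b ≠ c)
    (hsbc : s b = s c) :
    ∃ V V' : Set Y, IsOpen V ∧ IsOpen V' ∧ Disjoint V V' ∧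
      Large p q (Function.update (Function.update s b (s b ∩ q ⁻¹' V)) c (s b ∩ q ⁻¹' V')) := by
  by_contra! hn
  have hn' : ∀ v : {v : TopologicalSpace.countableBasis Y × TopologicalSpace.countableBasis Y //
      Disjoint (v.1 : Set Y) v.2}, ∃ G, IsSigmaGraph G ∧ ¬ ∃ x, ∀ d, ∃ z ∈ (Function.update
        (Function.update s b (s b ∩ q ⁻¹' v.1.1)) c (s b ∩ q ⁻¹' v.1.2)) d,
        p z = x ∧ (p z, q z) ∉ G := by
    intro v
    have := hn v.1.1 v.1.2 (TopologicalSpace.isOpen_of_mem_countableBasis v.1.1.2)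
      (TopologicalSpace.isOpen_of_mem_countableBasis v.1.2.2) v.2
    simpa only [Large, not_forall, exists_prop] using this
  choose G hG hx using hn'
  have := (TopologicalSpace.countable_countableBasis Y).to_subtype
  have hG' : IsSigmaGraph (⋃ v, G v) := IsSigmaGraph.iUnion hG
  set H := ⋃ v, G v with hH
  obtain ⟨Γ, hΓ, hTΓ⟩ := exists_borelGraph_of_functional (W := β → Z)
    (T := {ζ | ∀ d, ζ d ∈ s d ∧ (p (ζ d), q (ζ d)) ∉ H ∧ p (ζ d) = p (ζ b)})
    (p := fun ζ => p (ζ b)) (q := fun ζ => q (ζ b))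
    (by
      simp only [Set.ofPred_forall]
      refine MeasurableSet.iInter fun d => ?_
      have hd : Measurable fun ζ : β → Z => ζ d := measurable_pi_apply d
      have hb : Measurable fun ζ : β → Z => ζ b := measurable_pi_apply b
      refine (hd (hm d)).inter (MeasurableSet.inter (MeasurableSet.compl ?_) ?_)
      · exact ((hp.comp hd).prodMk (hq.comp hd)) hG'.measurableSet
      · exact measurableSet_eq_fun (hp.comp hd) (hp.comp hb))
    (hp.comp (measurable_pi_apply b)) (hq.comp (measurable_pi_apply b))
    (by
      intro ζ hζ ζ' hζ' hpp
      by_contra hne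
      obtain ⟨O, O', hO, hO', hy, hy', hd⟩ := t2_separation hne
      obtain ⟨V, hV, hyV, hVO⟩ :=
        (TopologicalSpace.isBasis_countableBasis Y).exists_subset_of_mem_open hy hO
      obtain ⟨V', hV', hyV', hVO'⟩ :=
        (TopologicalSpace.isBasis_countableBasis Y).exists_subset_of_mem_open hy' hO'
      let v : {v : TopologicalSpace.countableBasis Y × TopologicalSpace.countableBasis Y //
        Disjoint (v.1 : Set Y) v.2} := ⟨(⟨V, hV⟩, ⟨V', hV'⟩), hd.mono hVO hVO'⟩
      have hGH : ∀ w, w ∉ H → w ∉ G v := fun w hw h => hw (Set.mem_iUnion.2 ⟨v, h⟩)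
      refine hx v ⟨p (ζ b), fun d => ?_⟩
      rcases eq_or_ne d c with rfl | hdc
      · refine ⟨ζ' b, ?_, hpp.symm, hGH _ (hζ' b).2.1⟩
        rw [Function.update_self]
        exact ⟨(hζ' b).1, hyV'⟩
      · refine ⟨ζ d, ?_, (hζ d).2.2, hGH _ (hζ d).2.1⟩
        rw [Function.update_of_ne hdc]
        rcases eq_or_ne d b with rfl | hdb
        · rw [Function.update_self]
          exact ⟨(hζ d).1, hyV⟩
        · rw [Function.update_of_ne hdb]
          exact (hζ d).1)
  obtain ⟨x, hx'⟩ := hs _ (hG'.union hΓ.isSigmaGraph)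
  choose ζ hζ hζx hζG using hx'
  refine hζG b (Or.inr (hTΓ ζ fun d => ⟨hζ d, fun h => hζG d (Or.inl h), ?_⟩))
  rw [hζx, hζx]

theorem exists_countable_small_cover [PseudoMetricSpace Z] [SecondCountableTopology Z] {O : Set Z}
    (hO : IsOpen O) {ε : ℝ} (hε : 0 < ε) :
    ∃ C : Set (Set Z), C.Countable ∧ O ⊆ ⋃ B : C, (B : Set Z) ∧
      ∀ B ∈ C, IsOpen B ∧ closure B ⊆ O ∧ ∀ z ∈ B, ∀ w ∈ B, dist z w ≤ ε := by
  refine ⟨{B ∈ TopologicalSpace.countableBasis Z |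
    closure B ⊆ O ∧ ∀ z ∈ B, ∀ w ∈ B, dist z w ≤ ε},
    (TopologicalSpace.countable_countableBasis Z).mono fun B hB => hB.1, ?_,
    fun B hB => ⟨TopologicalSpace.isOpen_of_mem_countableBasis hB.1, hB.2⟩⟩
  intro z hz
  obtain ⟨r, hr, hrO⟩ := Metric.isOpen_iff.1 hO z hz
  have hδ : 0 < min (r / 2) (ε / 2) := by positivity
  obtain ⟨B, hB, hzB, hBs⟩ := (TopologicalSpace.isBasis_countableBasis Z).exists_subset_of_mem_open
    (Metric.mem_ball_self hδ) Metric.isOpen_ball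
  refine Set.mem_iUnion.2 ⟨⟨B, hB, ?_, ?_⟩, hzB⟩
  · refine (closure_mono hBs).trans (Metric.closure_ball_subset_closedBall.trans fun w hw => hrO ?_)
    rw [Metric.mem_closedBall] at hw
    rw [Metric.mem_ball]
    have := min_le_left (r / 2) (ε / 2)
    linarith
  · intro u hu w hw
    have hu' := Metric.mem_ball.1 (hBs hu)
    have hw' := Metric.mem_ball.1 (hBs hw)
    have := min_le_right (r / 2) (ε / 2)
    have := dist_triangle_right u w z
    linarith

theorem Large.split_small [MetricSpace Z] [CompleteSpace Z] [SecondCountableTopology Z]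
    [Countable β] [DecidableEq β] {p : Z → X} {q : Z → Y} (hp : Continuous p) (hq : Continuous q)
    {s : β → Set Z} (hs : Large p q s) (ho : ∀ b, IsOpen (s b)) {b c : β} (hbc : b ≠ c)
    (hsbc : s b = s c) {ε : ℝ} (hε : 0 < ε) :
    ∃ S S' : Set Z, (IsOpen S ∧ closure S ⊆ s b ∧ ∀ z ∈ S, ∀ w ∈ S, dist z w ≤ ε) ∧
      (IsOpen S' ∧ closure S' ⊆ s b ∧ ∀ z ∈ S', ∀ w ∈ S', dist z w ≤ ε) ∧
      (∀ z ∈ S, ∀ w ∈ S', q z ≠ q w) ∧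
      Large p q (Function.update (Function.update s b S) c S') := by
  borelize Z
  obtain ⟨V, V', hV, hV', hd, hL⟩ :=
    hs.split hp.measurable hq.measurable (fun b => (ho b).measurableSet) hbc hsbc
  obtain ⟨C, hC, hcov, hCp⟩ := exists_countable_small_cover ((ho b).inter (hV.preimage hq)) hε
  obtain ⟨C', hC', hcov', hCp'⟩ := exists_countable_small_cover ((ho b).inter (hV'.preimage hq)) hε
  have := hC.to_subtype
  have := hC'.to_subtype
  obtain ⟨⟨S, hS⟩, hL⟩ := hL.refine b (fun k : C => (k : Set Z)) (by
    rwa [Function.update_of_ne hbc, Function.update_self])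
  obtain ⟨⟨S', hS'⟩, hL⟩ := hL.refine c (fun k : C' => (k : Set Z)) (by
    rwa [Function.update_of_ne hbc.symm, Function.update_self])
  obtain ⟨h1, h2, h3⟩ := hCp S hS
  obtain ⟨h1', h2', h3'⟩ := hCp' S' hS'
  refine ⟨S, S', ⟨h1, h2.trans Set.inter_subset_left, h3⟩,
    ⟨h1', h2'.trans Set.inter_subset_left, h3'⟩, ?_, ?_⟩
  · intro z hz w hw h
    refine Set.disjoint_left.1 hd (h2 (subset_closure hz)).2 ?_
    rw [h]
    exact (h2' (subset_closure hw)).2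
  · convert hL using 1
    rw [Function.update_comm hbc.symm, Function.update_idem, Function.update_idem]

/-- One level of the splitting construction: every member of a large family of open sets is
replaced by two small open subsets with disjoint images in the second coordinate. -/
theorem Large.exists_split_all [MetricSpace Z] [CompleteSpace Z] [SecondCountableTopology Z]
    [Finite β] {p : Z → X} {q : Z → Y} (hp : Continuous p) (hq : Continuous q)
    {s : β → Set Z} (hs : Large p q s) (ho : ∀ b, IsOpen (s b)) {ε : ℝ} (hε : 0 < ε) :
    ∃ t : β × Bool → Set Z, (∀ d, IsOpen (t d)) ∧ Large p q t ∧
      (∀ d, closure (t d) ⊆ s d.1 ∧ ∀ z ∈ t d, ∀ w ∈ t d, dist z w ≤ ε) ∧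
      ∀ b, ∀ z ∈ t (b, false), ∀ w ∈ t (b, true), q z ≠ q w := by
  classical
  have := Fintype.ofFinite β
  suffices h : ∀ B : Finset β, ∃ t : β × Bool → Set Z, (∀ d, IsOpen (t d)) ∧ Large p q t ∧
      (∀ d, d.1 ∉ B → t d = s d.1) ∧
      (∀ d, d.1 ∈ B → closure (t d) ⊆ s d.1 ∧ ∀ z ∈ t d, ∀ w ∈ t d, dist z w ≤ ε) ∧
      ∀ b ∈ B, ∀ z ∈ t (b, false), ∀ w ∈ t (b, true), q z ≠ q w by
    obtain ⟨t, h1, h2, -, h3, h4⟩ := h Finset.univ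
    exact ⟨t, h1, h2, fun d => h3 d (Finset.mem_univ _), fun b => h4 b (Finset.mem_univ _)⟩
  intro B
  induction B using Finset.induction_on with
  | empty =>
    refine ⟨fun d => s d.1, fun d => ho d.1, fun G hG => ?_, by simp, by simp, by simp⟩
    obtain ⟨x, hx⟩ := hs G hG
    exact ⟨x, fun d => hx d.1⟩
  | insert b B hb ih =>
    obtain ⟨t, hto, htL, hts, htB, htq⟩ := ih
    obtain ⟨S, S', hS, hS', hq', hL⟩ := htL.split_small hp hq hto
      (b := (b, false)) (c := (b, true)) (by simp) ((hts (b, false) hb).trans (hts (b, true) hb).symm) hε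
    rw [hts _ hb] at hS hS'
    set u := Function.update (Function.update t (b, false) S) (b, true) S' with hu
    have hu0 : u (b, false) = S := by simp [hu]
    have hu1 : u (b, true) = S' := by simp [hu]
    have hun : ∀ d : β × Bool, d.1 ≠ b → u d = t d := by
      rintro ⟨d, c⟩ hd
      rw [hu, Function.update_of_ne (by rintro ⟨⟩; exact hd rfl),
        Function.update_of_ne (by rintro ⟨⟩; exact hd rfl)]
    refine ⟨u, ?_, hL, ?_, ?_, ?_⟩
    · rintro ⟨d, c⟩
      rcases eq_or_ne d b with rfl | hd
      · cases c
        · exact hu0 ▸ hS.1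
        · exact hu1 ▸ hS'.1
      · exact hun (d, c) hd ▸ hto _
    · intro d hd
      rw [Finset.mem_insert, not_or] at hd
      rw [hun d hd.1, hts d hd.2]
    · rintro ⟨d, c⟩ hdB
      rcases eq_or_ne d b with rfl | hd
      · cases c
        · rw [hu0]; exact hS.2
        · rw [hu1]; exact hS'.2
      · rw [hun (d, c) hd]
        exact htB _ ((Finset.mem_insert.1 hdB).resolve_left hd)
    · intro d hdB
      rcases eq_or_ne d b with rfl | hd
      · rw [hu0, hu1]; exact hq'
      · rw [hun (d, _) hd, hun (d, _) hd]
        exact htq _ ((Finset.mem_insert.1 hdB).resolve_left hd)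

/-- Binary sequences of length `n`. -/
def BinaryLevel : ℕ → Type
  | 0 => Unit
  | n + 1 => BinaryLevel n × Bool

instance BinaryLevel.finite : ∀ n, Finite (BinaryLevel n)
  | 0 => inferInstanceAs (Finite Unit)
  | n + 1 => have := BinaryLevel.finite n; inferInstanceAs (Finite (BinaryLevel n × Bool))

/-- The initial segment of length `n` of an infinite binary sequence. -/
def BinaryLevel.initial (a : ℕ → Bool) : ∀ n, BinaryLevel n
  | 0 => ()
  | n + 1 => (BinaryLevel.initial a n, a n)

/-- If the whole parameter space is large, some vertical section is uncountable. -/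
theorem Large.exists_uncountable [MetricSpace Z] [CompleteSpace Z] [SecondCountableTopology Z]
    {p : Z → X} {q : Z → Y} (hp : Continuous p) (hq : Continuous q)
    (hL : Large p q fun _ : Unit => (Set.univ : Set Z)) :
    ∃ x, ¬ (q '' {z | p z = x}).Countable := by
  have hpow : ∀ n : ℕ, (0 : ℝ) < (1 / 2) ^ n := fun n => by positivity
  choose! F hFo hFL hFs hFq using fun (n : ℕ) (s : BinaryLevel n → Set Z)
    (h : Large p q s ∧ ∀ b, IsOpen (s b)) => h.1.exists_split_all hp hq h.2 (hpow n)
  let S : ∀ n, BinaryLevel n → Set Z :=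
    fun n => Nat.rec (motive := fun n => BinaryLevel n → Set Z) (fun _ => Set.univ) F n
  have hS : ∀ n, Large p q (S n) ∧ ∀ b, IsOpen (S n b) := by
    intro n
    induction n with
    | zero => exact ⟨hL, fun _ => isOpen_univ⟩
    | succ n ih => exact ⟨hFL n _ ih, hFo n _ ih⟩
  have hx : ∀ n, ∃ x, ∀ b, ∃ z ∈ S n b, p z = x := fun n => by
    obtain ⟨x, hx⟩ := (hS n).1 ∅ isSigmaGraph_empty
    exact ⟨x, fun b => (hx b).imp fun z hz => ⟨hz.1, hz.2.1⟩⟩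
  choose x w hw hwx using hx
  have hsub : ∀ a n, closure (S (n + 1) (BinaryLevel.initial a (n + 1))) ⊆
      S n (BinaryLevel.initial a n) := fun a n =>
    (hFs n (S n) (hS n) (BinaryLevel.initial a n, a n)).1
  have hanti : ∀ a {m n}, m ≤ n →
      S n (BinaryLevel.initial a n) ⊆ S m (BinaryLevel.initial a m) := fun a =>
    @antitone_nat_of_succ_le _ _ (fun n => S n (BinaryLevel.initial a n))
      fun n => subset_closure.trans (hsub a n)
  have hcau : ∀ a, CauchySeq fun n => w (n + 1) (BinaryLevel.initial a (n + 1)) := fun a => by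
    refine cauchySeq_of_le_geometric (1 / 2) 1 (by norm_num) fun n => ?_
    rw [one_mul]
    exact (hFs n (S n) (hS n) (BinaryLevel.initial a n, a n)).2 _
      (hw (n + 1) (BinaryLevel.initial a (n + 1))) _
      (hanti a (Nat.le_succ (n + 1)) (hw (n + 2) (BinaryLevel.initial a (n + 2))))
  choose z hz using fun a => cauchySeq_tendsto_of_complete (hcau a)
  have hzS : ∀ a n, z a ∈ S n (BinaryLevel.initial a n) := fun a n => by
    refine hsub a n (mem_closure_of_tendsto (hz a) ?_)
    filter_upwards [Filter.eventually_ge_atTop n] with m hm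
    exact hanti a (Nat.succ_le_succ hm) (hw (m + 1) (BinaryLevel.initial a (m + 1)))
  have hzx : ∀ a, Filter.Tendsto (fun n => x (n + 1)) Filter.atTop (nhds (p (z a))) := fun a => by
    refine ((hp.tendsto _).comp (hz a)).congr fun n => ?_
    exact hwx _ _
  have hinj : Function.Injective fun a => q (z a) := by
    intro a a' haa
    by_contra hne
    have hex : ∃ n, a n ≠ a' n := by
      by_contra! h
      exact hne (funext h)
    classical
    have hmin : ∀ m ≤ Nat.find hex, BinaryLevel.initial a m = BinaryLevel.initial a' m := by
      intro m
      induction m with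
      | zero => exact fun _ => rfl
      | succ m ih =>
        intro hm
        have h := not_not.1 (Nat.find_min hex (m := m) (by lia))
        simp only [BinaryLevel.initial]
        rw [ih (by lia), h]
    have hn := Nat.find_spec hex
    set n := Nat.find hex with hndef
    have h1 := hzS a (n + 1)
    have h2 := hzS a' (n + 1)
    have hE := hmin n le_rfl
    simp only [BinaryLevel.initial, ← hE] at h1 h2
    have hq := hFq n (S n) (hS n) (BinaryLevel.initial a n)
    cases ha : a n <;> cases ha' : a' n <;> rw [ha] at h1 <;> rw [ha'] at h2
    · exact hn (ha.trans ha'.symm)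
    · exact hq _ h1 _ h2 haa
    · exact hq _ h2 _ h1 haa.symm
    · exact hn (ha.trans ha'.symm)
  refine ⟨p (z fun _ => false), fun hc => ?_⟩
  have hrange : Set.range (fun a => q (z a)) ⊆ q '' {z' | p z' = p (z fun _ => false)} := by
    rintro _ ⟨a, rfl⟩
    exact ⟨z a, tendsto_nhds_unique (hzx a) (hzx _), rfl⟩
  have hcr : Countable (ℕ → Bool) := by
    have := (hc.mono hrange).to_subtype
    exact (Set.rangeFactorization_injective.2 hinj).countable
  obtain ⟨f, hf⟩ := exists_surjective_nat (ℕ → Bool)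
  obtain ⟨n, hn⟩ := hf fun n => !(f n n)
  simpa using congrFun hn n

/-- The **Lusin–Novikov theorem**: a Borel set with countable vertical sections is covered by
countably many Borel graphs. -/
theorem exists_isSigmaGraph_of_countable_sections {X Y : Type} [MeasurableSpace X]
    [StandardBorelSpace X] [MeasurableSpace Y] [StandardBorelSpace Y] {P : Set (X × Y)}
    (hP : MeasurableSet P) (hc : ∀ x, {y | (x, y) ∈ P}.Countable) :
    ∃ G, IsSigmaGraph G ∧ P ⊆ G := by
  let := upgradeStandardBorel X
  let := upgradeStandardBorel Y
  have hA := hP.analyticSet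
  rw [MeasureTheory.AnalyticSet] at hA
  rcases hA with rfl | ⟨g, hg, rfl⟩
  · exact ⟨∅, isSigmaGraph_empty, subset_rfl⟩
  let := TopologicalSpace.upgradeIsCompletelyMetrizable (ℕ → ℕ)
  by_contra! hn
  obtain ⟨x, hx⟩ := Large.exists_uncountable (p := fun z => (g z).1) (q := fun z => (g z).2)
    (continuous_fst.comp hg) (continuous_snd.comp hg) (by
      intro G hG
      obtain ⟨_, ⟨z, rfl⟩, hz⟩ := Set.not_subset.1 (hn G hG)
      exact ⟨(g z).1, fun _ => ⟨z, trivial, rfl, hz⟩⟩)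
  refine hx ((hc x).mono ?_)
  rintro _ ⟨z, rfl, rfl⟩
  exact ⟨z, rfl⟩

end LusinNovikov

section FullPseudogroup

/-- A Borel function extending a Borel graph which is injective over its first projection. -/
theorem exists_measurable_eq_snd {X : Type} [MeasurableSpace X] [StandardBorelSpace X]
    [Nonempty X] {Γ : Set (X × X)} (hΓ : MeasurableSet Γ) (h : Set.InjOn Prod.fst Γ) :
    ∃ g : X → X, Measurable g ∧ ∀ p ∈ Γ, g p.1 = p.2 := by
  have := hΓ.standardBorel
  have he : MeasurableEmbedding fun p : Γ => (p : X × X).1 :=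
    (measurable_fst.comp measurable_subtype_coe).measurableEmbedding
      fun p q hpq => Subtype.ext (h p.2 q.2 hpq)
  obtain ⟨g, hg, hgp⟩ := he.exists_measurable_extend
    (measurable_snd.comp measurable_subtype_coe : Measurable fun p : Γ => (p : X × X).2)
    fun _ => inferInstance
  exact ⟨g, hg, fun p hp => congrFun hgp ⟨p, hp⟩⟩

/-- A Borel set both of whose coordinate projections are injective is the graph of a partial
Borel isomorphism. -/
theorem exists_pbi_of_injOn {X : Type} [MeasurableSpace X] [StandardBorelSpace X]
    [Nonempty X] {Γ : Set (X × X)} (hΓ : MeasurableSet Γ) (h₁ : Set.InjOn Prod.fst Γ)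
    (h₂ : Set.InjOn Prod.snd Γ) :
    ∃ φ : PBI X, φ.src = Prod.fst '' Γ ∧ ∀ p ∈ Γ, φ.toFun p.1 = p.2 := by
  obtain ⟨g, hg, hgp⟩ := exists_measurable_eq_snd hΓ h₁
  obtain ⟨k, hk, hkp⟩ := exists_measurable_eq_snd (Γ := Prod.swap ⁻¹' Γ) (measurable_swap hΓ)
    (fun p hp q hq hpq => Prod.swap_injective (h₂ hp hq hpq))
  have hkp' : ∀ p ∈ Γ, k p.2 = p.1 := fun p hp => hkp p.swap (by simpa using hp)
  refine ⟨⟨Prod.fst '' Γ, Prod.snd '' Γ, hΓ.image_of_measurable_injOn measurable_fst h₁,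
    hΓ.image_of_measurable_injOn measurable_snd h₂, g, k, hg, hk, ?_, ?_, ?_, ?_⟩, rfl, hgp⟩
  · rintro _ ⟨p, hp, rfl⟩
    exact ⟨p, hp, (hgp p hp).symm⟩
  · rintro _ ⟨p, hp, rfl⟩
    exact ⟨p, hp, (hkp' p hp).symm⟩
  · rintro _ ⟨p, hp, rfl⟩
    rw [hgp p hp, hkp' p hp]
  · rintro _ ⟨p, hp, rfl⟩
    rw [hkp' p hp, hgp p hp]

/-- A countable Borel equivalence relation is a countable union of graphs of elements of its
full pseudogroup. -/
theorem CBER.exists_pbi_cover {X : Type} [MeasurableSpace X] [StandardBorelSpace X]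
    [Nonempty X] (R : CBER X) :
    ∃ Φ : ℕ → PBI X, (∀ n, R.InPseudogroup (Φ n)) ∧
      ∀ x y, R.rel x y → ∃ n, x ∈ (Φ n).src ∧ (Φ n).toFun x = y := by
  obtain ⟨_, ⟨C, hC, hCg, rfl⟩, hPC⟩ :=
    exists_isSigmaGraph_of_countable_sections R.rel_meas R.countable_classes
  obtain ⟨Γ, hΓ⟩ := (hC.insert ∅).exists_eq_range (Set.insert_nonempty _ _)
  have hg : ∀ n, IsBorelGraph (Γ n) := by
    intro n
    rcases (hΓ ▸ Set.mem_range_self n : Γ n ∈ insert ∅ C) with h | h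
    · rw [h]
      exact ⟨MeasurableSet.empty, fun _ _ _ h => h.elim⟩
    · exact hCg _ h
  have hcov : ∀ x y, R.rel x y → ∃ n, (x, y) ∈ Γ n := by
    intro x y h
    obtain ⟨G, hG, hxy⟩ := hPC (show (x, y) ∈ {p : X × X | R.rel p.1 p.2} from h)
    obtain ⟨n, rfl⟩ : G ∈ Set.range Γ := hΓ ▸ Set.mem_insert_of_mem _ hG
    exact ⟨n, hxy⟩
  have hφ : ∀ n : ℕ × ℕ, ∃ φ : PBI X,
      φ.src = Prod.fst '' (Γ n.1 ∩ Prod.swap ⁻¹' Γ n.2 ∩ {p | R.rel p.1 p.2}) ∧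
      ∀ p ∈ Γ n.1 ∩ Prod.swap ⁻¹' Γ n.2 ∩ {p | R.rel p.1 p.2}, φ.toFun p.1 = p.2 := by
    intro n
    refine exists_pbi_of_injOn
      (((hg n.1).1.inter (measurable_swap (hg n.2).1)).inter R.rel_meas) ?_ ?_
    · rintro ⟨x, y⟩ hp ⟨x', y'⟩ hq rfl
      exact congrArg _ ((hg n.1).2 _ _ _ hp.1.1 hq.1.1)
    · rintro ⟨x, y⟩ hp ⟨x', y'⟩ hq rfl
      exact congrArg (·, y) ((hg n.2).2 _ _ _ hp.1.2 hq.1.2)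
  choose φ hsrc hval using hφ
  refine ⟨fun n => φ n.unpair, fun n => ⟨?_, ?_⟩, fun x y h => ?_⟩
  · rw [hsrc]
    rintro _ ⟨p, hp, rfl⟩
    exact (R.rel_dom hp.2).1
  · rw [hsrc]
    rintro _ ⟨p, hp, rfl⟩
    rw [hval _ p hp]
    exact hp.2
  · obtain ⟨m, hm⟩ := hcov x y h
    obtain ⟨n, hn⟩ := hcov y x (R.symm h)
    have hmem : (x, y) ∈ Γ (Nat.unpair (Nat.pair m n)).1 ∩
        Prod.swap ⁻¹' Γ (Nat.unpair (Nat.pair m n)).2 ∩ {p | R.rel p.1 p.2} := by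
      rw [Nat.unpair_pair]
      exact ⟨⟨hm, hn⟩, h⟩
    exact ⟨Nat.pair m n, by rw [hsrc]; exact ⟨_, hmem, rfl⟩, hval _ _ hmem⟩

/-- The saturation of a Borel set is Borel. -/
theorem CBER.measurableSet_sat {X : Type} [MeasurableSpace X] [StandardBorelSpace X]
    [Nonempty X] (R : CBER X) {A : Set X} (hA : MeasurableSet A) : MeasurableSet (R.sat A) := by
  obtain ⟨Φ, hΦ, hcov⟩ := R.exists_pbi_cover
  have : R.sat A = ⋃ n, (Φ n).src ∩ (Φ n).toFun ⁻¹' A := by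
    ext y
    simp only [CBER.sat, Set.mem_ofPred_eq, Set.mem_iUnion, Set.mem_inter_iff, Set.mem_preimage]
    constructor
    · rintro ⟨x, hx, h⟩
      obtain ⟨n, hn, rfl⟩ := hcov _ _ (R.symm h)
      exact ⟨n, hn, hx⟩
    · rintro ⟨n, hn, hx⟩
      exact ⟨_, hx, R.symm ((hΦ n).2 y hn)⟩
  rw [this]
  exact MeasurableSet.iUnion fun n => (Φ n).src_meas.inter ((Φ n).meas_toFun hA)

/-- The saturation of a null set under a measure preserving relation is null. -/
theorem CBER.IsPMP.measure_sat_eq_zero_s15 {X : Type} [MeasurableSpace X] [StandardBorelSpace X]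
    [Nonempty X] {R : CBER X} {μ : Measure X} (hR : R.IsPMP μ) {A : Set X}
    (hA : MeasurableSet A) (h0 : μ A = 0) : μ (R.sat A) = 0 := by
  obtain ⟨Φ, hΦ, hcov⟩ := R.exists_pbi_cover
  refine measure_mono_null (t := ⋃ n, (Φ n).toFun '' (A ∩ (Φ n).src)) ?_
    (measure_iUnion_null fun n => ?_)
  · rintro y ⟨x, hx, h⟩
    obtain ⟨n, hn, rfl⟩ := hcov _ _ h
    exact Set.mem_iUnion.2 ⟨n, x, ⟨hx, hn⟩, rfl⟩
  · rw [hR (Φ n) (hΦ n) _ Set.inter_subset_right (hA.inter (Φ n).src_meas)]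
    exact measure_mono_null Set.inter_subset_left h0

/-- A conull Borel set contains an invariant conull Borel set. -/
theorem CBER.IsPMP.exists_invariant_conull {X : Type} [MeasurableSpace X]
    [StandardBorelSpace X] [Nonempty X] {R : CBER X} {μ : Measure X} (hR : R.IsPMP μ)
    {C : Set X} (hC : MeasurableSet C) (h0 : μ Cᶜ = 0) :
    ∃ D ⊆ C, MeasurableSet D ∧ μ Dᶜ = 0 ∧ ∀ x y, R.rel x y → x ∈ D → y ∈ D := by
  refine ⟨(Cᶜ ∪ R.sat Cᶜ)ᶜ, ?_, (hC.compl.union (R.measurableSet_sat hC.compl)).compl, ?_, ?_⟩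
  · rw [Set.compl_subset_comm]
    exact Set.subset_union_left
  · rw [compl_compl]
    exact measure_union_null h0 (hR.measure_sat_eq_zero_s15 hC.compl h0)
  · rintro x y hxy hx (hy | ⟨z, hz, hzy⟩)
    · exact hx (Or.inr ⟨y, hy, R.symm hxy⟩)
    · exact hx (Or.inr ⟨z, hz, R.trans hzy (R.symm hxy)⟩)

/-- A Borel map moving each point of the saturation of `Y` along `R` into `Y`, and fixing all
points of `Y` and all points outside the saturation. -/
theorem CBER.exists_measurable_retraction {X : Type} [MeasurableSpace X]
    [StandardBorelSpace X] [Nonempty X] (R : CBER X) {Y : Set X} (hY : MeasurableSet Y) :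
    ∃ f : X → X, Measurable f ∧ (∀ x ∈ Y, f x = x) ∧
      ∀ x ∈ R.sat Y, f x ∈ Y ∧ R.rel x (f x) := by
  obtain ⟨Φ, hΦ, hcov⟩ := R.exists_pbi_cover
  let F : ℕ → X → X
    | 0, x => x
    | n + 1, x => (Φ n).toFun x
  let p : ℕ → X → Prop
    | 0, x => x ∈ Y ∨ x ∉ R.sat Y
    | n + 1, x => x ∈ (Φ n).src ∧ (Φ n).toFun x ∈ Y
  have hp : ∀ x, ∃ n, p n x := by
    intro x
    by_cases hx : x ∈ R.sat Y
    · obtain ⟨y, hy, h⟩ := hx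
      obtain ⟨n, hn, hny⟩ := hcov _ _ (R.symm h)
      exact ⟨n + 1, hn, by rwa [hny]⟩
    · exact ⟨0, Or.inr hx⟩
  have : ∀ n, DecidablePred (p n) := fun _ => Classical.decPred _
  refine ⟨fun x => F (Nat.find (hp x)) x, Measurable.find ?_ ?_ hp, ?_, ?_⟩
  · rintro (_ | n)
    · exact measurable_id
    · exact (Φ n).meas_toFun
  · rintro (_ | n)
    · exact hY.union (R.measurableSet_sat hY).compl
    · exact (Φ n).src_meas.inter ((Φ n).meas_toFun hY)
  · intro x hx
    have : Nat.find (hp x) = 0 := (Nat.find_eq_zero (hp x)).2 (Or.inl hx)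
    simp only [this]
    rfl
  · intro x hx
    have hs := Nat.find_spec (hp x)
    beta_reduce
    generalize Nat.find (hp x) = n at hs ⊢
    rcases n with _ | n
    · have hxY : x ∈ Y := hs.resolve_right (not_not.2 hx)
      obtain ⟨y, -, h⟩ := hx
      exact ⟨hxY, R.refl _ (R.rel_dom h).2⟩
    · exact ⟨hs.2, (hΦ n).2 x hs.1⟩

/-- The image of a Borel set under a Borel map whose graph is contained in `R` is Borel. -/
theorem CBER.measurableSet_image {X : Type} [MeasurableSpace X] [StandardBorelSpace X]
    [Nonempty X] (R : CBER X) {f : X → X} (hf : Measurable f) {A : Set X}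
    (hA : MeasurableSet A) (h : ∀ x ∈ A, R.rel x (f x)) : MeasurableSet (f '' A) := by
  obtain ⟨Φ, hΦ, hcov⟩ := R.exists_pbi_cover
  have : f '' A = ⋃ n, (Φ n).src ∩ ((Φ n).toFun ⁻¹' A ∩ {w | f ((Φ n).toFun w) = w}) := by
    ext w
    simp only [Set.mem_image, Set.mem_iUnion, Set.mem_inter_iff, Set.mem_preimage,
      Set.mem_ofPred_eq]
    constructor
    · rintro ⟨x, hx, rfl⟩
      obtain ⟨n, hn, hnx⟩ := hcov _ _ (R.symm (h x hx))
      exact ⟨n, hn, by rwa [hnx], by rw [hnx]⟩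
    · rintro ⟨n, -, hx, hw⟩
      exact ⟨_, hx, hw⟩
  rw [this]
  exact MeasurableSet.iUnion fun n => (Φ n).src_meas.inter (((Φ n).meas_toFun hA).inter
    (measurableSet_eq_fun (hf.comp (Φ n).meas_toFun) measurable_id))

end FullPseudogroup

section ExtendedDecomposition

/-- The pullback of `S` along `f` to the set `D`, together with the restriction of `R` to `N`. -/
def CBER.pullbackUnion {X : Type} [MeasurableSpace X] (R S : CBER X) {f : X → X}
    (hf : Measurable f) {D N : Set X} (hD : MeasurableSet D) (hN : MeasurableSet N)
    (hDN : Disjoint D N) (hDS : ∀ x ∈ D, f x ∈ S.dom) (hSR : ∀ x y, S.rel x y → R.rel x y)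
    (hfR : ∀ x ∈ D, R.rel x (f x)) : CBER X where
  dom := D ∪ (N ∩ R.dom)
  dom_meas := hD.union (hN.inter R.dom_meas)
  rel x y := (x ∈ D ∧ y ∈ D ∧ S.rel (f x) (f y)) ∨ (x ∈ N ∧ y ∈ N ∧ R.rel x y)
  rel_meas := by
    have hff : Measurable fun p : X × X => (f p.1, f p.2) :=
      (hf.comp measurable_fst).prodMk (hf.comp measurable_snd)
    exact ((measurable_fst hD).inter ((measurable_snd hD).inter (hff S.rel_meas))).union
      ((measurable_fst hN).inter ((measurable_snd hN).inter R.rel_meas))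
  rel_dom := by
    rintro x y (⟨hx, hy, -⟩ | ⟨hx, hy, h⟩)
    · exact ⟨Or.inl hx, Or.inl hy⟩
    · exact ⟨Or.inr ⟨hx, (R.rel_dom h).1⟩, Or.inr ⟨hy, (R.rel_dom h).2⟩⟩
  refl := by
    rintro x (hx | hx)
    · exact Or.inl ⟨hx, hx, S.refl _ (hDS x hx)⟩
    · exact Or.inr ⟨hx.1, hx.1, R.refl _ hx.2⟩
  symm := by
    rintro x y (⟨hx, hy, h⟩ | ⟨hx, hy, h⟩)
    · exact Or.inl ⟨hy, hx, S.symm h⟩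
    · exact Or.inr ⟨hy, hx, R.symm h⟩
  trans := by
    rintro x y z (⟨hx, hy, h⟩ | ⟨hx, hy, h⟩) (⟨hy', hz, h'⟩ | ⟨hy', hz, h'⟩)
    · exact Or.inl ⟨hx, hz, S.trans h h'⟩
    · exact (hDN.notMem_of_mem_left hy hy').elim
    · exact (hDN.notMem_of_mem_left hy' hy).elim
    · exact Or.inr ⟨hx, hz, R.trans h h'⟩
  countable_classes := by
    refine fun x => (R.countable_classes x).mono ?_
    rintro y (⟨hx, hy, h⟩ | ⟨-, -, h⟩)
    · exact R.trans (hfR x hx) (R.trans (hSR _ _ h) (R.symm (hfR y hy)))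
    · exact h

/-- The endpoints of a reduced path in a freely independent family are distinct. -/
theorem FreelyIndep.path_ne {X : Type} [MeasurableSpace X] {ι : Type} {S : ι → CBER X}
    (hS : FreelyIndep S) {x : ℕ → X} {i : ℕ → ι} {a b : ℕ} (hab : a < b)
    (hne : ∀ k, a ≤ k → k < b → x k ≠ x (k + 1))
    (hrel : ∀ k, a ≤ k → k < b → (S (i k)).rel (x k) (x (k + 1)))
    (hi : ∀ k, a ≤ k → k + 1 < b → i k ≠ i (k + 1)) : x a ≠ x b := by
  intro h
  obtain ⟨n, rfl⟩ := Nat.exists_eq_add_of_lt hab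
  rcases n with _ | n
  · exact hne a le_rfl hab h
  · obtain ⟨k, hk, hik⟩ := hS (n + 2) (fun k => x (a + k)) (fun k => i (a + k)) (by omega)
      h.symm (fun k hk => hne (a + k) (by omega) (by omega))
      (fun k hk => hrel (a + k) (by omega) (by omega))
    exact hi (a + k) (by omega) (by omega) hik

/-- Free independence passes from a family on `Y` to its pullbacks along a retraction `f` onto
`Y`, provided the domains of the pullbacks are disjoint outside of `Y`. -/
theorem FreelyIndep.pullback {X : Type} [MeasurableSpace X] {ι : Type} {S T : ι → CBER X}
    (hS : FreelyIndep S) {f : X → X} {Y Z : Set X} {D : ι → Set X} {j₀ : ι}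
    (hf : ∀ x ∈ Y, f x = x) (hDZ : ∀ j, D j ⊆ Z)
    (hD : ∀ i j x, x ∉ Y → x ∈ D i → x ∈ D j → i = j)
    (hT : ∀ j x y, (T j).rel x y → (x ∈ D j ∧ y ∈ D j ∧ (S j).rel (f x) (f y)) ∨
      (j = j₀ ∧ x ∉ Z ∧ y ∉ Z)) : FreelyIndep T := by
  intro n x i hn hx hne hrel
  by_contra! hcon
  by_cases h0 : x 0 ∈ Z
  swap
  · rcases hT _ _ _ (hrel 0 (by omega)) with h | ⟨hi0, -, h1⟩
    · exact h0 (hDZ _ h.1)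
    rcases hT _ _ _ (hrel 1 (by omega)) with h | ⟨hi1, -, -⟩
    · exact h1 (hDZ _ h.1)
    exact hcon 0 (by omega) (hi0.trans hi1.symm)
  have hZ : ∀ k ≤ n, x k ∈ Z := by
    intro k
    induction k with
    | zero => exact fun _ => h0
    | succ k ih =>
      intro hk
      rcases hT _ _ _ (hrel k (by omega)) with h | h
      · exact hDZ _ h.2.1
      · exact (h.2.1 (ih (by omega))).elim
  have hrel' : ∀ k < n, x k ∈ D (i k) ∧ x (k + 1) ∈ D (i k) ∧
      (S (i k)).rel (f (x k)) (f (x (k + 1))) := fun k hk =>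
    (hT _ _ _ (hrel k hk)).resolve_right fun h => h.2.1 (hZ k hk.le)
  have hfix : ∀ k, 0 < k → k < n → f (x k) = x k := by
    intro k hk hkn
    obtain ⟨m, rfl⟩ := Nat.exists_eq_succ_of_ne_zero hk.ne'
    by_contra hm
    exact hcon m hkn (hD _ _ _ (fun h => hm (hf _ h)) (hrel' m (by omega)).2.1
      (hrel' (m + 1) hkn).1)
  by_cases hY : x 0 ∈ Y
  · have hfix' : ∀ k ≤ n, f (x k) = x k := by
      intro k hk
      rcases Nat.eq_zero_or_pos k with rfl | hk0
      · exact hf _ hY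
      rcases hk.eq_or_lt with rfl | hkn
      · rw [hx]
        exact hf _ hY
      · exact hfix k hk0 hkn
    refine hS.path_ne (x := x) (i := i) (a := 0) (b := n) (by omega) (fun k _ => hne k)
      (fun k _ hk => ?_) (fun k _ => hcon k) hx.symm
    have := (hrel' k hk).2.2
    rwa [hfix' k hk.le, hfix' (k + 1) hk] at this
  rcases hn.eq_or_lt with rfl | hn3
  · exact hcon 0 (by omega) (hD _ _ _ hY (hrel' 0 (by omega)).1
      (hx ▸ (hrel' 1 (by omega)).2.1))
  obtain ⟨a, ha1, haf, ha0⟩ : ∃ a ≤ 1, f (x a) = f (x 0) ∧ (a = 0 → x 1 ≠ f (x 0)) := by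
    by_cases h : x 1 = f (x 0)
    · exact ⟨1, le_rfl, by rw [hfix 1 (by omega) (by omega), h], by omega⟩
    · exact ⟨0, by omega, rfl, fun _ => h⟩
  obtain ⟨b, hb1, hbn, hbf, hb0⟩ : ∃ b, n - 1 ≤ b ∧ b ≤ n ∧ f (x b) = f (x 0) ∧
      (b = n → x (n - 1) ≠ f (x 0)) := by
    by_cases h : x (n - 1) = f (x 0)
    · exact ⟨n - 1, le_rfl, by omega, by rw [hfix (n - 1) (by omega) (by omega), h], by omega⟩
    · exact ⟨n, by omega, le_rfl, by rw [hx], fun _ => h⟩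
  refine hS.path_ne (x := fun k => f (x k)) (i := i) (a := a) (b := b) (by omega)
    (fun k hak hkb => ?_) (fun k _ hk => (hrel' k (by omega)).2.2)
    (fun k _ hk => hcon k (by omega)) (haf.trans hbf.symm)
  rcases Nat.eq_zero_or_pos k with rfl | hk0
  · rw [hfix (0 + 1) (by omega) (by omega)]
    exact (ha0 (by omega)).symm
  rcases Nat.lt_or_ge (k + 1) n with hkn | hkn
  · rw [hfix k hk0 (by omega), hfix (k + 1) (by omega) hkn]
    exact hne k (by omega)
  · obtain rfl : n = k + 1 := by omega
    rw [hfix k hk0 (by omega), hx]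
    exact hb0 (by omega)

/-- A countable family of Borel sets can be refined to a disjoint one with the same union. -/
theorem exists_disjoint_refinement {X : Type} [MeasurableSpace X] {ι : Type} [Countable ι]
    {A : ι → Set X} (hA : ∀ j, MeasurableSet (A j)) :
    ∃ E : ι → Set X, (∀ j, MeasurableSet (E j)) ∧ (∀ j, E j ⊆ A j) ∧
      (∀ i j x, x ∈ E i → x ∈ E j → i = j) ∧ ∀ j, ∀ x ∈ A j, ∃ i, x ∈ E i := by
  obtain ⟨e, he⟩ := exists_injective_nat ι
  refine ⟨fun j => A j \ ⋃ i, ⋃ _ : e i < e j, A i, fun j => (hA j).diff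
    (MeasurableSet.iUnion fun i => MeasurableSet.iUnion fun _ => hA i),
    fun j => Set.sdiff_subset, ?_, ?_⟩
  · rintro i j x ⟨hi, hi'⟩ ⟨hj, hj'⟩
    simp only [Set.mem_iUnion, not_exists] at hi' hj'
    by_contra hij
    rcases lt_or_gt_of_ne (he.ne hij) with h | h
    · exact hj' i h hi
    · exact hi' j h hj
  · intro j x hx
    obtain ⟨i, hi, hmin⟩ := (measure e).wf.has_min {i | x ∈ A i} ⟨j, hx⟩
    refine ⟨i, hi, ?_⟩
    simp only [Set.mem_iUnion, not_exists]
    exact fun k hk hxk => hmin k hxk hk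

/-- A free product decomposition of `R|Y` extends to one of `R` whose factors, on the saturation
of `Y`, are pulled back along a retraction. -/
theorem IsFreeProduct.exists_extension {X : Type} [MeasurableSpace X] [StandardBorelSpace X]
    [Nonempty X] {R : CBER X} {Y : Set X} {hY : MeasurableSet Y} {ι : Type} [Countable ι]
    [Nonempty ι] {S : ι → CBER X} (hS : IsFreeProduct (R.restrict Y hY) S) {f : X → X}
    (hf : Measurable f) (hfY : ∀ x ∈ Y, f x = x)
    (hfZ : ∀ x ∈ R.sat Y, f x ∈ Y ∧ R.rel x (f x)) :
    ∃ T : ι → CBER X, IsFreeProduct R T ∧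
      ∀ j, ∀ x ∈ R.sat Y, ∀ y, (T j).rel x y → (S j).rel (f x) (f y) := by
  obtain ⟨hind, hdom, hgen⟩ := hS
  have hSR : ∀ j x y, (S j).rel x y → R.rel x y := fun j x y h =>
    ((hgen x y).2 ⟨hdom ▸ Set.mem_iUnion.2 ⟨j, ((S j).rel_dom h).1⟩,
      Relation.EqvGen.rel _ _ ⟨j, h⟩⟩).1
  have hSY : ∀ j, (S j).dom ⊆ R.dom ∩ Y := fun j x hx =>
    (hdom ▸ Set.mem_iUnion.2 ⟨j, hx⟩ : x ∈ (R.restrict Y hY).dom)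
  have hYS : ∀ x ∈ R.dom, x ∈ Y → ∃ j, x ∈ (S j).dom := fun x hx hxY =>
    Set.mem_iUnion.1 (hdom ▸ (⟨hx, hxY⟩ : x ∈ (R.restrict Y hY).dom))
  have hYZ : R.dom ∩ Y ⊆ R.sat Y := fun x hx => ⟨x, hx.2, R.refl x hx.1⟩
  have hZinv : ∀ x y, R.rel x y → x ∈ R.sat Y → y ∈ R.sat Y := fun x y h ⟨z, hz, hzx⟩ =>
    ⟨z, hz, R.trans hzx h⟩
  have hZ := R.measurableSet_sat hY
  obtain ⟨E, hE, hES, hEd, hEc⟩ := exists_disjoint_refinement fun j => (S j).dom_meas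
  obtain ⟨j₀⟩ := ‹Nonempty ι›
  let D : ι → Set X := fun j => (S j).dom ∪ (R.sat Y \ Y ∩ f ⁻¹' E j)
  let N : ι → Set X := fun j => {x | j = j₀ ∧ x ∉ R.sat Y}
  have hDZ : ∀ j, D j ⊆ R.sat Y := by
    rintro j x (hx | hx)
    · exact hYZ (hSY j hx)
    · exact hx.1.1
  have hDS : ∀ j, ∀ x ∈ D j, f x ∈ (S j).dom := by
    rintro j x (hx | hx)
    · rwa [hfY x (hSY j hx).2]
    · exact hES j hx.2
  let T : ι → CBER X := fun j => R.pullbackUnion (S j) hf (D := D j) (N := N j)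
    ((S j).dom_meas.union ((hZ.diff hY).inter (hf (hE j))))
    ((MeasurableSet.const (j = j₀)).inter hZ.compl)
    (Set.disjoint_left.2 fun x hx hx' => hx'.2 (hDZ j hx)) (hDS j) (hSR j)
    (fun x hx => (hfZ x (hDZ j hx)).2)
  have hTR : ∀ j x y, (T j).rel x y → R.rel x y := by
    rintro j x y (⟨hx, hy, h⟩ | ⟨-, -, h⟩)
    · exact R.trans (hfZ x (hDZ j hx)).2
        (R.trans (hSR _ _ _ h) (R.symm (hfZ y (hDZ j hy)).2))
    · exact h
  have hST : ∀ j x y, (S j).rel x y → (T j).rel x y := by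
    intro j x y h
    obtain ⟨hx, hy⟩ := (S j).rel_dom h
    refine Or.inl ⟨Or.inl hx, Or.inl hy, ?_⟩
    rwa [hfY x (hSY j hx).2, hfY y (hSY j hy).2]
  have hDc : ∀ x ∈ R.sat Y, ∃ j, x ∈ D j ∧ f x ∈ D j := by
    intro x hx
    obtain ⟨hfx, hxf⟩ := hfZ x hx
    by_cases hxY : x ∈ Y
    · obtain ⟨j, hj⟩ := hYS x (R.rel_dom hxf).1 hxY
      refine ⟨j, Or.inl hj, Or.inl ?_⟩
      rwa [hfY x hxY]
    · obtain ⟨i, hi⟩ := hYS (f x) (R.rel_dom hxf).2 hfx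
      obtain ⟨j, hj⟩ := hEc i _ hi
      exact ⟨j, Or.inr ⟨⟨hx, hxY⟩, hj⟩, Or.inl (hES j hj)⟩
  have hTf : ∀ x ∈ R.sat Y, Relation.EqvGen (fun a b => ∃ j, (T j).rel a b) x (f x) := by
    intro x hx
    obtain ⟨j, hj, hj'⟩ := hDc x hx
    refine Relation.EqvGen.rel _ _ ⟨j, Or.inl ⟨hj, hj', ?_⟩⟩
    rw [hfY (f x) (hfZ x hx).1]
    exact (S j).refl _ (hDS j x hj)
  refine ⟨T, ⟨?_, ?_, ?_⟩, ?_⟩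
  · refine hind.pullback (Z := R.sat Y) (D := D) (j₀ := j₀) hfY hDZ ?_ ?_
    · rintro i j x hxY (hi | hi) hj
      · exact (hxY (hSY i hi).2).elim
      rcases hj with hj | hj
      · exact (hxY (hSY j hj).2).elim
      exact hEd i j _ hi.2 hj.2
    · rintro j x y (h | ⟨hx, hy, -⟩)
      · exact Or.inl h
      · exact Or.inr ⟨hx.1, hx.2, hy.2⟩
  · ext x
    simp only [Set.mem_iUnion]
    constructor
    · intro hx
      by_cases hxZ : x ∈ R.sat Y
      · obtain ⟨j, hj, -⟩ := hDc x hxZ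
        exact ⟨j, Or.inl hj⟩
      · exact ⟨j₀, Or.inr ⟨⟨rfl, hxZ⟩, hx⟩⟩
    · rintro ⟨j, hj⟩
      exact (R.rel_dom (hTR j x x ((T j).refl x hj))).1
  · intro x y
    constructor
    · intro h
      refine ⟨(R.rel_dom h).1, ?_⟩
      by_cases hx : x ∈ R.sat Y
      · have hy := hZinv x y h hx
        have hxy : (R.restrict Y hY).rel (f x) (f y) :=
          ⟨R.trans (R.symm (hfZ x hx).2) (R.trans h (hfZ y hy).2), (hfZ x hx).1, (hfZ y hy).1⟩
        have hgen' := ((hgen _ _).1 hxy).2.mono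
          (fun a b ⟨j, hj⟩ => (⟨j, hST j a b hj⟩ : ∃ j, (T j).rel a b))
        exact (hTf x hx).trans _ _ _ (hgen'.trans _ _ _ ((hTf y hy).symm _ _))
      · exact Relation.EqvGen.rel _ _ ⟨j₀, Or.inr ⟨⟨rfl, hx⟩,
          ⟨rfl, fun hy => hx (hZinv y x (R.symm h) hy)⟩, h⟩⟩
    · rintro ⟨hx, h⟩
      have key : x = y ∨ R.rel x y := by
        clear hx
        induction h with
        | rel a b h =>
          obtain ⟨j, hj⟩ := h
          exact Or.inr (hTR j a b hj)
        | refl a => exact Or.inl rfl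
        | symm a b _ ih => exact ih.imp Eq.symm R.symm
        | trans a b c _ _ ih₁ ih₂ =>
          rcases ih₁ with rfl | h₁
          · exact ih₂
          rcases ih₂ with rfl | h₂
          · exact Or.inr h₁
          · exact Or.inr (R.trans h₁ h₂)
      rcases key with rfl | h
      · exact R.refl x hx
      · exact h
  · rintro j x hx y (h | h)
    · exact h.2.2
    · exact (h.1.2 hx).elim

end ExtendedDecomposition

/-- Free indecomposability passes to restrictions to non-null Borel sets. -/
theorem FI_restriction
    {X : Type} [MeasurableSpace X] [StandardBorelSpace X]
    (μ : MeasureTheory.Measure X) [MeasureTheory.IsProbabilityMeasure μ]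
    (R : CBER X) (hpmp : R.IsPMP μ)
    (hFI : FreelyIndecomposableMod μ R)
    (Y : Set X) (hY : MeasurableSet Y) (hpos : 0 < μ Y) :
    FreelyIndecomposableMod (μ.restrict Y) (R.restrict Y hY) := by
  intro ι _ S hS
  have hXne : Nonempty X := nonempty_of_isProbabilityMeasure μ
  rcases isEmpty_or_nonempty ι with hι | hι
  · refine ⟨fun _ => ∅, Set.univ, hι.elim, hι.elim, fun i => hι.elim i, MeasurableSet.univ,
      by simp, ?_, fun i => hι.elim i, fun i => hι.elim i⟩
    intro x hx
    have := hx.1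
    rw [hS.2.1, Set.mem_iUnion] at this
    exact hι.elim this.choose
  obtain ⟨f, hf, hfY, hfZ⟩ := R.exists_measurable_retraction hY
  obtain ⟨T, hT, hTS⟩ := hS.exists_extension hf hfY hfZ
  obtain ⟨U, C, hU, -, -, hC, hC0, hUc, hUd, hUT⟩ := hFI ι inferInstance T hT
  obtain ⟨C', hCC', hC', hC'0, hC'inv⟩ := hpmp.exists_invariant_conull hC hC0
  have hWd : ∀ i j, ∀ w ∈ f '' (U i ∩ (R.sat Y ∩ C')), ∀ w' ∈ f '' (U j ∩ (R.sat Y ∩ C')),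
      R.rel w w' → i = j := by
    rintro i j _ ⟨x, hx, rfl⟩ _ ⟨y, hy, rfl⟩ h
    exact hUd i j x ⟨hx.1, hCC' hx.2.2⟩ y ⟨hy.1, hCC' hy.2.2⟩
      (R.trans (hfZ x hx.2.1).2 (R.trans h (R.symm (hfZ y hy.2.1).2)))
  have hWdom : ∀ j, f '' (U j ∩ (R.sat Y ∩ C')) ⊆ R.dom ∩ Y := by
    rintro j _ ⟨x, hx, rfl⟩
    exact ⟨(R.rel_dom (hfZ x hx.2.1).2).2, (hfZ x hx.2.1).1⟩
  refine ⟨fun j => f '' (U j ∩ (R.sat Y ∩ C')), C', fun j => ?_, hWdom, ?_, hC', ?_, ?_, ?_, ?_⟩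
  · exact R.measurableSet_image hf ((hU j).inter ((R.measurableSet_sat hY).inter hC'))
      fun x hx => (hfZ x hx.2.1).2
  · intro i j hij
    exact Set.disjoint_left.2 fun w hi hj =>
      hij (hWd i j w hi w hj (R.refl w (hWdom i hi).1))
  · exact nonpos_iff_eq_zero.1 ((Measure.restrict_apply_le Y _).trans hC'0.le)
  · rintro x ⟨⟨hx, hxY⟩, hxC⟩
    obtain ⟨u, hu, hxu⟩ := hUc x ⟨hx, hCC' hxC⟩
    obtain ⟨j, hj⟩ := Set.mem_iUnion.1 hu
    have huZ : u ∈ R.sat Y := ⟨x, hxY, hxu⟩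
    exact ⟨f u, Set.mem_iUnion.2 ⟨j, u, ⟨hj, huZ, hC'inv x u hxu hxC⟩, rfl⟩,
      R.trans hxu (hfZ u huZ).2, hxY, (hfZ u huZ).1⟩
  · exact fun i j w hw w' hw' h => hWd i j w hw.1 w' hw'.1 h.1
  · rintro j w ⟨hw, -⟩ w' ⟨hw', -⟩
    constructor
    · obtain ⟨x, hx, rfl⟩ := hw
      obtain ⟨y, hy, rfl⟩ := hw'
      intro h
      refine hTS j x hx.2.1 y ((hUT j x ⟨hx.1, hCC' hx.2.2⟩ y ⟨hy.1, hCC' hy.2.2⟩).1 ?_)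
      exact R.trans (hfZ x hx.2.1).2 (R.trans h.1 (R.symm (hfZ y hy.2.1).2))
    · exact fun h => (hS.2.2 w w').2
        ⟨hS.2.1 ▸ Set.mem_iUnion.2 ⟨j, ((S j).rel_dom h).1⟩, Relation.EqvGen.rel _ _ ⟨j, h⟩⟩
end
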